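/- arXiv:2503.03728 — 3 statements merged into one kernel-verified Lean document; each statement's English description precedes it below -/
import Mathlib

section
/- Let φ = [Φ₁; Φ₂] be an n×(n−1) matrix over R = k[x_1,…,x_d] with ht I_{n−1}(φ) = 2 (so ker φ = 0), let f_1,…,f_a be the signed maximal minors of φ fixing the rows of Φ₂, assume the ideal J = (f_1,…,f_a) has height 2, and let ψ₁ : F₂ → R^{n−1} and ψ₂ : F₃ → F₂ be maps of free R-modules with Im ψ₁ = ker Φ₂ and Im ψ₂ = ker ψ₁. Then: (1) the kernel of the map R^a → R given by the row vector (f_1,…,f_a) equals the image of the composite Φ₁∘ψ₁; and (2) ker(Φ₁∘ψ₁) = Im ψ₂. Consequently, any graded free resolution of I/J (which is presented by Φ₂) of the form ⋯ → F₃ → F₂ →^{ψ₁} R(−D)^{n−1} →^{Φ₂} R(−(D−ε₂))^{n−a} → I/J → 0 yields the graded free resolution ⋯ → F₃ → F₂ →^{Φ₁ψ₁} R(−(D−ε₁))^a →^{(f_1,…,f_a)} R → R/J → 0, and depth R/J = depth I/J. -/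
set_option synthInstance.maxHeartbeats 1000000
set_option maxHeartbeats 1000000

open Matrix MvPolynomial

noncomputable section

def idealHeight {A : Type*} [CommRing A] (I : Ideal A) : ℕ∞ :=
  ⨅ (P : PrimeSpectrum A) (_ : I ≤ P.asIdeal), Order.height P

def minorsIdeal {A : Type*} [CommRing A] {p q : ℕ} (t : ℕ)
    (M : Matrix (Fin p) (Fin q) A) : Ideal A :=
  Ideal.span { x | ∃ (r : Fin t → Fin p) (c : Fin t → Fin q),
    Function.Injective r ∧ Function.Injective c ∧ x = (M.submatrix r c).det }

/-- Condition `G_s` of Artin–Nagata: for every prime `P ⊇ L` with `ht P ≤ s − 1`,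
the localization `L_P` can be generated by at most `ht P` elements. -/
def CondG {A : Type*} [CommRing A] (L : Ideal A) (s : ℕ) : Prop :=
  ∀ P : Ideal A, P.IsPrime → L ≤ P → idealHeight P + 1 ≤ (s : ℕ∞) →
    ∃ c : ℕ, (c : ℕ∞) ≤ idealHeight P ∧ ∃ g : Fin c → A, (∀ i, g i ∈ L) ∧
      ∀ x ∈ L, ∃ u ∉ P, u * x ∈ Ideal.span (Set.range g)

/-- The skew-symmetric matrix of signed `m × m` minors (obtained by omitting two columns)
of an `m × (m+2)` matrix; this is the middle differential of the Buchsbaum–Rim complex. -/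
def bbrim {A : Type*} [CommRing A] {m : ℕ} (ψ : Matrix (Fin m) (Fin (m + 2)) A) :
    Matrix (Fin (m + 2)) (Fin (m + 2)) A :=
  Matrix.of fun i j =>
    if h : (i : ℕ) < (j : ℕ) then
      (-1) ^ ((i : ℕ) + (j : ℕ)) *
        (ψ.submatrix id (fun q => j.succAbove
          ((⟨(i : ℕ), by have := j.isLt; omega⟩ : Fin (m + 1)).succAbove q))).det
    else if h' : (j : ℕ) < (i : ℕ) then
      (-1) ^ ((i : ℕ) + (j : ℕ) + 1) *
        (ψ.submatrix id (fun q => i.succAbove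
          ((⟨(j : ℕ), by have := i.isLt; omega⟩ : Fin (m + 1)).succAbove q))).det
    else 0

def rowMap {A : Type*} [CommRing A] {ι : Type*} [Fintype ι] (g : ι → A) :
    (ι → A) →ₗ[A] A :=
  ∑ i, g i • LinearMap.proj i

/-- Data of a (necessarily minimal) graded free resolution
`0 → ⊕_j R(−a_j) → ⊕_i R(−b_i) → I → 0` of an ideal of a polynomial ring. -/
def HasResolutionData {A : Type*} [CommRing A] {σ : Type*} (I : Ideal (MvPolynomial σ A))
    {N M : ℕ} (b : Fin N → ℕ) (a : Fin M → ℕ) : Prop :=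
  ∃ (g : Fin N → MvPolynomial σ A) (φ : Matrix (Fin N) (Fin M) (MvPolynomial σ A)),
    (∀ i, (g i).IsHomogeneous (b i)) ∧ Ideal.span (Set.range g) = I ∧
    (∀ i j, (φ i j).IsHomogeneous (a j - b i) ∧ (a j ≤ b i → φ i j = 0)) ∧
    Function.Injective φ.mulVecLin ∧
    LinearMap.range φ.mulVecLin = LinearMap.ker (rowMap g)

/-- The Castelnuovo–Mumford regularity of a codimension-two perfect ideal, read off from
its minimal graded free resolution `0 → ⊕_j R(−a_j) → ⊕_i R(−b_i) → I → 0` as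
`max(max_i b_i, max_j a_j − 1)`. -/
def HasRegularity {A : Type*} [CommRing A] {σ : Type*} (I : Ideal (MvPolynomial σ A))
    (r : ℕ) : Prop :=
  ∃ (N M : ℕ) (b : Fin N → ℕ) (a : Fin M → ℕ), HasResolutionData I b a ∧
    (Finset.univ.sup b) ⊔ ((Finset.univ.sup a) - 1) = r

def IsCohenMacaulayRing (A : Type*) [CommRing A] : Prop :=
  ∀ P : Ideal A, P.IsMaximal → ∃ rs : List A,
    (∀ x ∈ rs, x ∈ P) ∧ RingTheory.Sequence.IsRegular A rs ∧
      (rs.length : ℕ∞) = idealHeight P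

def reesPresentation {A : Type*} [CommRing A] {n : ℕ} (f : Fin n → A) :
    MvPolynomial (Fin n) A →ₐ[A] Polynomial A :=
  MvPolynomial.aeval fun i => Polynomial.C (f i) * Polynomial.X

def Ideal.IsLinearType {A : Type*} [CommRing A] (I : Ideal A) : Prop :=
  ∀ (n : ℕ) (f : Fin n → A), Ideal.span (Set.range f) = I →
    RingHom.ker (reesPresentation f) =
      Ideal.span {p | p ∈ RingHom.ker (reesPresentation f) ∧ p.IsHomogeneous 1}

def moduleDepth {A : Type*} [CommRing A] (J : Ideal A) (M : Type*)
    [AddCommGroup M] [Module A M] : ℕ∞ :=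
  sSup {c : ℕ∞ | ∃ rs : List A, (∀ x ∈ rs, x ∈ J) ∧
    RingTheory.Sequence.IsRegular M rs ∧ (rs.length : ℕ∞) = c}

def analyticSpread {A : Type*} [CommRing A] (m I : Ideal A) : WithBot ℕ∞ :=
  ringKrullDim ((reesAlgebra I) ⧸ (Ideal.map (algebraMap A (reesAlgebra I)) m))

section Points

variable {k : Type*} [Field k]

def gradedPiece (I : Ideal (MvPolynomial (Fin 3) k)) (t : ℕ) :
    Submodule k (MvPolynomial (Fin 3) k) :=
  Submodule.restrictScalars k I ⊓ homogeneousSubmodule (Fin 3) k t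

def pointIdeal (p : Fin 3 → k) : Ideal (MvPolynomial (Fin 3) k) :=
  Ideal.span {f | f.IsHomogeneous 1 ∧ MvPolynomial.eval p f = 0}

def vanishingIdeal {n : ℕ} (pts : Fin n → (Fin 3 → k)) : Ideal (MvPolynomial (Fin 3) k) :=
  ⨅ i, pointIdeal (pts i)

def oneTimesPiece (I : Ideal (MvPolynomial (Fin 3) k)) (s : ℕ) :
    Submodule k (MvPolynomial (Fin 3) k) :=
  Submodule.span k {g | ∃ ℓ f, ℓ ∈ homogeneousSubmodule (Fin 3) k 1 ∧
    f ∈ gradedPiece I s ∧ g = ℓ * f}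

def IsPointFamily {n : ℕ} (pts : Fin n → (Fin 3 → k)) : Prop :=
  (∀ i, pts i ≠ 0) ∧ ∀ i j, i ≠ j → ∀ c : k, pts i ≠ c • pts j

def InGenericPosition {n : ℕ} (pts : Fin n → (Fin 3 → k)) : Prop :=
  ∀ t : ℕ, Module.finrank k (gradedPiece (vanishingIdeal pts) t) = (t + 2).choose 2 - n

def InUniformPosition {n : ℕ} (pts : Fin n → (Fin 3 → k)) : Prop :=
  ∀ T : Finset (Fin n), ∀ t : ℕ,
    Module.finrank k (gradedPiece (⨅ i ∈ T, pointIdeal (pts i)) t) = (t + 2).choose 2 - T.card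

def HasInitialDegree (I : Ideal (MvPolynomial (Fin 3) k)) (s : ℕ) : Prop :=
  gradedPiece I s ≠ ⊥ ∧ ∀ t < s, gradedPiece I t = ⊥

def InTightGenericPosition {n : ℕ} (pts : Fin n → (Fin 3 → k)) (s : ℕ) : Prop :=
  InGenericPosition pts ∧
    Module.finrank k (oneTimesPiece (vanishingIdeal pts) s) =
      min (3 * Module.finrank k (gradedPiece (vanishingIdeal pts) s))
        (Module.finrank k (gradedPiece (vanishingIdeal pts) (s + 1)))

def IsBirationalOntoImage {N : ℕ} (f : Fin N → MvPolynomial (Fin 3) k) : Prop :=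
  ∃ (e : ℕ) (G : Fin 3 → MvPolynomial (Fin N) k) (w : MvPolynomial (Fin 3) k),
    w ≠ 0 ∧ (∀ j, (G j).IsHomogeneous e) ∧
      ∀ j, MvPolynomial.aeval f (G j) = w * MvPolynomial.X j

end Points

end

/-- The maximal minors of an `(m + 1) × m` matrix, with the signs of a Laplace expansion. -/
def signedMinor {A : Type*} [CommRing A] {m : ℕ} (φ : Matrix (Fin (m + 1)) (Fin m) A)
    (i : Fin (m + 1)) : A :=
  (-1) ^ (i : ℕ) * (φ.submatrix i.succAbove id).det

theorem rowMap_apply {A : Type*} [CommRing A] {ι : Type*} [Fintype ι] (g c : ι → A) :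
    rowMap g c = ∑ i, g i * c i := by
  simp [rowMap]

theorem range_rowMap {A : Type*} [CommRing A] {ι : Type*} [Fintype ι] (g : ι → A) :
    LinearMap.range (rowMap g) = Ideal.span (Set.range g) := by
  ext x
  simp only [LinearMap.mem_range, rowMap_apply]
  rw [Ideal.mem_span_range_iff_exists_fun]
  simp only [mul_comm]

section HilbertBurch

variable {A : Type*} {m : ℕ}

/-- The square matrix obtained by adding `c` as a first column. -/
def addColumn (c : Fin (m + 1) → A) (φ : Matrix (Fin (m + 1)) (Fin m) A) :
    Matrix (Fin (m + 1)) (Fin (m + 1)) A :=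
  Matrix.of fun i => Fin.cons (c i) (φ i)

theorem addColumn_submatrix (c : Fin (m + 1) → A) (φ : Matrix (Fin (m + 1)) (Fin m) A)
    (i : Fin (m + 1)) :
    (addColumn c φ).submatrix i.succAbove Fin.succ = φ.submatrix i.succAbove id := by
  ext; simp [addColumn]

variable [CommRing A]

theorem det_addColumn (c : Fin (m + 1) → A) (φ : Matrix (Fin (m + 1)) (Fin m) A) :
    (addColumn c φ).det = rowMap (signedMinor φ) c := by
  rw [Matrix.det_succ_column_zero, rowMap_apply]
  refine Finset.sum_congr rfl fun i _ => ?_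
  rw [addColumn_submatrix, signedMinor]
  simp only [addColumn, Matrix.of_apply, Fin.cons_zero]
  ring

theorem rowMap_signedMinor_mulVec (φ : Matrix (Fin (m + 1)) (Fin m) A) (v : Fin m → A) :
    rowMap (signedMinor φ) (φ *ᵥ v) = 0 := by
  have hcol (j : Fin m) : rowMap (signedMinor φ) (φ.col j) = 0 := by
    rw [← det_addColumn]
    exact Matrix.det_zero_of_column_eq (Fin.succ_ne_zero j).symm fun i => by
      simp [addColumn, Matrix.col]
  rw [Matrix.mulVec_eq_sum, map_sum]
  refine Finset.sum_eq_zero fun j _ => ?_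
  have := hcol j
  rw [op_smul_eq_smul, map_smul]
  exact (congrArg (v j • ·) this).trans (smul_zero _)

theorem exists_mulVec_eq_signedMinor_smul (φ : Matrix (Fin (m + 1)) (Fin m) A)
    {c : Fin (m + 1) → A} (hc : rowMap (signedMinor φ) c = 0) (i : Fin (m + 1)) :
    ∃ w, φ *ᵥ w = signedMinor φ i • c := by
  refine ⟨-fun j => (addColumn c φ).adjugate j.succ i, ?_⟩
  have h := Matrix.mul_adjugate (addColumn c φ)
  rw [det_addColumn, hc, zero_smul] at h
  have h0 : (addColumn c φ).adjugate 0 i = signedMinor φ i := by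
    rw [Matrix.adjugate_fin_succ_eq_det_submatrix, signedMinor, Fin.succAbove_zero,
      addColumn_submatrix]
    simp
  ext l
  have hl := congrFun (congrFun h l) i
  rw [Matrix.mul_apply, Fin.sum_univ_succ, h0] at hl
  simp only [addColumn, Matrix.of_apply, Fin.cons_zero, Fin.cons_succ, Matrix.zero_apply] at hl
  simp only [Pi.neg_apply, Pi.smul_apply, smul_eq_mul, Matrix.mulVec, dotProduct, mul_neg,
    Finset.sum_neg_distrib, addColumn]
  linear_combination -hl

theorem mulVec_injective_of_signedMinor_ne_zero [IsDomain A]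
    {φ : Matrix (Fin (m + 1)) (Fin m) A} {i : Fin (m + 1)} (hi : signedMinor φ i ≠ 0) :
    Function.Injective φ.mulVecLin := by
  rw [← LinearMap.ker_eq_bot, LinearMap.ker_eq_bot']
  intro v hv
  have hdet : (φ.submatrix i.succAbove id).det ≠ 0 := fun h => hi (by simp [signedMinor, h])
  refine Matrix.eq_zero_of_mulVec_eq_zero hdet ?_
  ext l
  exact congrFun hv (i.succAbove l)

theorem span_signedMinor (φ : Matrix (Fin (m + 1)) (Fin m) A) :
    Ideal.span (Set.range (signedMinor φ)) = minorsIdeal m φ := by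
  apply le_antisymm <;> rw [minorsIdeal, Ideal.span_le]
  · rintro _ ⟨i, rfl⟩
    exact Ideal.mul_mem_left _ _ (Ideal.subset_span
      ⟨i.succAbove, id, Fin.succAbove_right_injective, Function.injective_id, rfl⟩)
  · rintro _ ⟨r, c, hr, hc, rfl⟩
    obtain ⟨i, hi⟩ : ∃ i, i ∉ Set.range r := by
      by_contra! h
      have := Fintype.card_le_of_surjective r h
      simp at this
    choose s hs using fun l => Fin.exists_succAbove_eq (x := r l) (y := i) fun h => hi ⟨l, h⟩
    have hs' : Function.Injective s := fun x y hxy => hr (by rw [← hs, ← hs, hxy])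
    let σ := Equiv.ofBijective s (Finite.injective_iff_bijective.1 hs')
    let τ := Equiv.ofBijective c (Finite.injective_iff_bijective.1 hc)
    have h : φ.submatrix r c =
        ((φ.submatrix i.succAbove id).submatrix σ id).submatrix id τ := by
      ext x y
      simp [σ, τ, hs]
    have hdet : (φ.submatrix i.succAbove id).det = (-1) ^ (i : ℕ) * signedMinor φ i := by
      rw [signedMinor, ← mul_assoc, ← mul_pow]
      simp
    rw [h, Matrix.det_permute', Matrix.det_permute, hdet]
    exact Ideal.mul_mem_left _ _ (Ideal.mul_mem_left _ _ (Ideal.mul_mem_left _ _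
      (Ideal.subset_span ⟨i, rfl⟩)))

end HilbertBurch

theorem exists_mem_not_dvd_of_prime {A : Type*} [CommRing A] [IsNoetherianRing A]
    {L : Ideal A} (hL : 2 ≤ idealHeight L) {p : A} (hp : Prime p) : ∃ x ∈ L, ¬ p ∣ x := by
  by_contra! h
  have hP : (Ideal.span {p}).IsPrime := (Ideal.span_singleton_prime hp.ne_zero).2 hp
  have h1 := Ideal.height_span_singleton_le_one hp.not_isUnit
  have h2 : 2 ≤ Order.height (⟨_, hP⟩ : PrimeSpectrum A) :=
    hL.trans (iInf₂_le _ fun x hx => Ideal.mem_span_singleton.2 (h x hx))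
  rw [← PrimeSpectrum.height_eq_orderHeight] at h2
  exact absurd (h2.trans h1) (by decide)

/-- An ideal of height at least two in a factorial ring has grade at least two. -/
theorem dvd_of_forall_mem_dvd_mul {A : Type*} [CommRing A] [IsDomain A] [IsNoetherianRing A]
    [UniqueFactorizationMonoid A] {L : Ideal A} (hL : 2 ≤ idealHeight L) {e : A} (he : e ≠ 0)
    {w : A} (h : ∀ x ∈ L, e ∣ x * w) : e ∣ w := by
  induction e using UniqueFactorizationMonoid.induction_on_prime generalizing w with
  | h₁ => exact absurd rfl he
  | h₂ e hu => exact hu.dvd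
  | h₃ e p he' hp ih =>
    obtain ⟨x, hx, hpx⟩ := exists_mem_not_dvd_of_prime hL hp
    obtain ⟨w, rfl⟩ := (hp.dvd_or_dvd ((dvd_mul_right p e).trans (h x hx))).resolve_left hpx
    refine mul_dvd_mul_left p (ih he' fun y hy => ?_)
    have := h y hy
    rwa [mul_left_comm, mul_dvd_mul_iff_left hp.ne_zero] at this

theorem exists_ne_zero_of_two_le_idealHeight {A : Type*} [CommRing A] [IsDomain A]
    {ι : Type*} {g : ι → A} (hg : 2 ≤ idealHeight (Ideal.span (Set.range g))) :
    ∃ i, g i ≠ 0 := by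
  by_contra! h
  have hbot : Ideal.span (Set.range g) = ⊥ := by
    rw [Ideal.span_eq_bot]
    rintro _ ⟨i, rfl⟩
    exact h i
  have h2 : 2 ≤ Order.height (⊥ : PrimeSpectrum A) :=
    hg.trans (iInf₂_le _ (by rw [hbot]; exact bot_le))
  simp at h2

/-- The exactness part of the Hilbert–Burch theorem over a factorial ring. -/
theorem range_mulVecLin_eq_ker_rowMap {A : Type*} [CommRing A] [IsDomain A] [IsNoetherianRing A]
    [UniqueFactorizationMonoid A] {m : ℕ} {φ : Matrix (Fin (m + 1)) (Fin m) A}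
    (hI : 2 ≤ idealHeight (Ideal.span (Set.range (signedMinor φ)))) :
    LinearMap.range φ.mulVecLin = LinearMap.ker (rowMap (signedMinor φ)) := by
  apply le_antisymm
  · rintro _ ⟨v, rfl⟩
    exact rowMap_signedMinor_mulVec φ v
  intro c hc
  obtain ⟨i, hi⟩ := exists_ne_zero_of_two_le_idealHeight hI
  have hinj := mulVec_injective_of_signedMinor_ne_zero hi
  choose w hw using exists_mulVec_eq_signedMinor_smul φ hc
  have hcomm (j) : signedMinor φ j • w i = signedMinor φ i • w j := hinj <| by
    simp only [Matrix.mulVecLin_apply, Matrix.mulVec_smul, hw, smul_comm (signedMinor φ j)]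
  have hdvd (l) : signedMinor φ i ∣ w i l := by
    refine dvd_of_forall_mem_dvd_mul hI hi fun x hx => ?_
    obtain ⟨b, rfl⟩ := Ideal.mem_span_range_iff_exists_fun.1 hx
    rw [Finset.sum_mul]
    refine Finset.dvd_sum fun j _ => ?_
    rw [mul_assoc]
    exact Dvd.dvd.mul_left ⟨w j l, congrFun (hcomm j) l⟩ _
  choose v hv using hdvd
  refine ⟨v, smul_right_injective _ hi ?_⟩
  change signedMinor φ i • φ *ᵥ v = signedMinor φ i • c
  rw [← hw, ← Matrix.mulVec_smul]
  exact congrArg _ (funext fun l => (hv l).symm)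

section ExtVanishing

universe u

open CategoryTheory CategoryTheory.Abelian

variable {A : Type u} [CommRing A]

/-- The groups `Ext^i(K, M)` vanish for all `i < n`. -/
def ExtVanishesBelow (K : ModuleCat.{u} A) (n : ℕ) (M : Type u) [AddCommGroup M] [Module A M] :
    Prop :=
  ∀ i < n, Subsingleton (Ext K (ModuleCat.of A M) i)

variable {K : ModuleCat.{u} A} {n : ℕ} {M₁ M₂ M₃ : Type u} [AddCommGroup M₁] [Module A M₁]
  [AddCommGroup M₂] [Module A M₂] [AddCommGroup M₃] [Module A M₃]
  {f : M₁ →ₗ[A] M₂} {g : M₂ →ₗ[A] M₃}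

theorem Function.Exact.moduleCat_shortExact (hfg : Function.Exact f g)
    (hf : Function.Injective f) (hg : Function.Surjective g) :
    (ModuleCat.shortComplexOfCompEqZero f g hfg.linearMap_comp_eq_zero).ShortExact :=
  ModuleCat.shortComplex_shortExact _ hfg hf hg

theorem ExtVanishesBelow.middle (hfg : Function.Exact f g) (hf : Function.Injective f)
    (hg : Function.Surjective g) (h₁ : ExtVanishesBelow K n M₁) (h₃ : ExtVanishesBelow K n M₃) :
    ExtVanishesBelow K n M₂ := by
  intro i hi
  have := h₁ i hi
  have := h₃ i hi
  refine subsingleton_of_forall_eq 0 fun x => ?_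
  obtain ⟨y, rfl⟩ := Ext.covariant_sequence_exact₂ K (hfg.moduleCat_shortExact hf hg) x
    (Subsingleton.elim (α := Ext K (ModuleCat.of A M₃) i) _ _)
  rw [Subsingleton.elim (α := Ext K (ModuleCat.of A M₁) i) y 0, Ext.zero_comp]

theorem ExtVanishesBelow.right (hfg : Function.Exact f g) (hf : Function.Injective f)
    (hg : Function.Surjective g) (h₁ : ExtVanishesBelow K (n + 1) M₁)
    (h₂ : ExtVanishesBelow K n M₂) : ExtVanishesBelow K n M₃ := by
  intro i hi
  have := h₁ (i + 1) (by lia)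
  have := h₂ i hi
  refine subsingleton_of_forall_eq 0 fun x => ?_
  obtain ⟨y, rfl⟩ := Ext.covariant_sequence_exact₃ K (hfg.moduleCat_shortExact hf hg) x rfl
    (Subsingleton.elim (α := Ext K (ModuleCat.of A M₁) (i + 1)) _ _)
  rw [Subsingleton.elim (α := Ext K (ModuleCat.of A M₂) i) y 0, Ext.zero_comp]

theorem ExtVanishesBelow.left (hfg : Function.Exact f g) (hf : Function.Injective f)
    (hg : Function.Surjective g) (h₂ : ExtVanishesBelow K n M₂)
    (h₃ : ExtVanishesBelow K (n - 1) M₃) : ExtVanishesBelow K n M₁ := by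
  intro i hi
  have := h₂ i hi
  refine subsingleton_of_forall_eq 0 fun x => ?_
  have hx : x.comp (Ext.mk₀ (ModuleCat.ofHom f)) (add_zero i) = 0 :=
    Subsingleton.elim (α := Ext K (ModuleCat.of A M₂) i) _ _
  cases i with
  | zero =>
    have : Mono (ModuleCat.ofHom f) := (ModuleCat.mono_iff_injective _).mpr hf
    exact Ext.postcomp_mk₀_injective_of_mono K (ModuleCat.ofHom f) (by simpa using hx)
  | succ i =>
    have := h₃ i (by lia)
    obtain ⟨y, rfl⟩ := Ext.covariant_sequence_exact₁ K (hfg.moduleCat_shortExact hf hg) x hx rfl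
    rw [Subsingleton.elim (α := Ext K (ModuleCat.of A M₃) i) y 0, Ext.zero_comp]

theorem ExtVanishesBelow.pi (h : ExtVanishesBelow K n A) (m : ℕ) :
    ExtVanishesBelow K n (Fin m → A) := by
  induction m with
  | zero =>
    intro i _
    refine subsingleton_of_forall_eq 0 fun x => ?_
    have hid : 𝟙 (ModuleCat.of A (Fin 0 → A)) = 0 := by
      ext x j
      exact j.elim0
    rw [← x.comp_mk₀_id, hid, Ext.mk₀_zero, Ext.comp_zero]
  | succ m ih =>
    refine middle (f := LinearMap.single A (fun _ : Fin (m + 1) => A) 0)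
      (g := LinearMap.funLeft A A Fin.succ) ?_ ?_ ?_ h ih
    · intro c
      constructor
      · intro hc
        refine ⟨c 0, ?_⟩
        ext j
        cases j using Fin.cases with
        | zero => simp
        | succ j => simpa using (congrFun hc j).symm
      · rintro ⟨c, rfl⟩
        ext j
        simp [LinearMap.funLeft_apply]
    · exact Pi.single_injective (M := fun _ : Fin (m + 1) => A) 0
    · exact LinearMap.funLeft_surjective_of_injective A A _ (Fin.succ_injective m)

/-- Rees' characterization of depth, for a single length. -/
theorem exists_isRegular_iff_extVanishesBelow [IsNoetherianRing A] (𝔞 : Ideal A) (n : ℕ)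
    (M : Type u) [AddCommGroup M] [Module A M] [Module.Finite A M]
    (hM : 𝔞 • (⊤ : Submodule A M) ≠ ⊤) :
    (∃ rs : List A, (∀ x ∈ rs, x ∈ 𝔞) ∧ RingTheory.Sequence.IsRegular M rs ∧ rs.length = n) ↔
      ExtVanishesBelow (ModuleCat.of A (Shrink.{u} (A ⧸ 𝔞))) n M := by
  have h := ((ModuleCat.exists_isRegular_tfae 𝔞 n (ModuleCat.of A M) hM.lt_top).out 1 3).symm
  refine Iff.trans ?_ h
  exact exists_congr fun rs => by tauto

end ExtVanishing

section Dimension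

variable {A : Type*} [CommRing A]

theorem supportDim_add_length_le [IsNoetherianRing A] {M : Type*} [AddCommGroup M] [Module A M]
    [Module.Finite A M] {rs : List A} (h : RingTheory.Sequence.IsRegular M rs) :
    (rs.length : WithBot ℕ∞) ≤ Module.supportDim A M := by
  induction rs generalizing M with
  | nil =>
    have := h.nontrivial
    have hne := Module.supportDim_ne_bot_of_nontrivial A M
    obtain ⟨c, hc⟩ := WithBot.ne_bot_iff_exists.1 hne
    rw [← hc]
    simp
  | cons x rs ih =>
    obtain ⟨hx, hrs⟩ := (RingTheory.Sequence.isRegular_cons_iff M x rs).1 h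
    refine le_trans ?_ (Module.supportDim_quotSMulTop_succ_le_of_notMem_minimalPrimes (x := x)
      fun p hp => hx.notMem_of_mem_minimalPrimes hp)
    rw [List.length_cons, Nat.cast_add, Nat.cast_one]
    gcongr
    exact ih hrs

theorem length_add_height_head_le {α : Type*} [Preorder α] (p : LTSeries α) :
    p.length + Order.height p.head ≤ Order.height p.last := by
  induction hn : p.length generalizing p with
  | zero =>
    have : p.head = p.last := by
      rw [RelSeries.head, RelSeries.last]; congr 1; ext; simp [hn]
    simp [this]
  | succ n ih =>
    have hlt : p.eraseLast.last < p.last := p.eraseLast_last_rel_last (by lia)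
    have := ih p.eraseLast (by simp [hn])
    rw [RelSeries.head_eraseLast] at this
    calc ((n + 1 : ℕ) : ℕ∞) + Order.height p.head = n + Order.height p.head + 1 := by
          push_cast; ring
      _ ≤ Order.height p.eraseLast.last + 1 := by gcongr
      _ ≤ Order.height p.last := Order.height_add_one_le hlt

theorem supportDim_add_le_ringKrullDim {M : Type*} [AddCommGroup M] [Module A M] {J : Ideal A}
    {h : ℕ} (hJ : h ≤ idealHeight J) (hM : J ≤ Module.annihilator A M) :
    Module.supportDim A M + h ≤ ringKrullDim A := by
  nontriviality M
  have : Nonempty (Module.support A M) := Module.nonempty_support_of_nontrivial.to_subtype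
  rw [Module.supportDim, Order.krullDim_eq_iSup_length]
  have key (p : LTSeries (Module.support A M)) : (p.length : ℕ∞) + h ≤ ringKrullDim A := by
    have hhead : J ≤ p.head.1.asIdeal := hM.trans (Module.annihilator_le_of_mem_support p.head.2)
    have h2 := length_add_height_head_le (p.map Subtype.val fun _ _ h => h)
    have h3 : (p.length : ℕ∞) + h ≤ Order.height (p.last.1) := by
      refine le_trans ?_ h2
      exact add_le_add le_rfl (hJ.trans (iInf₂_le p.head.1 hhead))
    exact (WithBot.coe_le_coe.2 h3).trans (Order.height_le_krullDim _)
  have : Nontrivial A := Module.nontrivial A M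
  obtain ⟨D, hD⟩ : ∃ D : ℕ∞, (D : WithBot ℕ∞) = ringKrullDim A :=
    WithBot.ne_bot_iff_exists.1 (Order.krullDim_ne_bot_iff.2 inferInstance)
  rw [← hD] at key ⊢
  refine WithBot.coe_le_coe.2 (?_ : (⨆ p : LTSeries (Module.support A M), (p.length : ℕ∞)) + h ≤ D)
  rw [ENat.iSup_add]
  exact iSup_le fun p => WithBot.coe_le_coe.1 (key p)

end Dimension

section MainTheorem

universe u

variable {k : Type u} [Field k] {d : ℕ}

theorem isRegular_finRange_X :
    RingTheory.Sequence.IsRegular (MvPolynomial (Fin d) k)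
      ((List.finRange d).map (X : Fin d → MvPolynomial (Fin d) k)) := by
  have hspan (l : List (Fin d)) :
      Ideal.ofList (l.map (X : Fin d → MvPolynomial (Fin d) k)) =
        Ideal.span (X '' {i | i ∈ l}) := by
    rw [Ideal.ofList]
    congr 1
    ext x
    simp
  refine ⟨⟨fun i hi => ?_⟩, fun h => ?_⟩
  · have hid : i < d := by simpa using hi
    rw [smul_eq_mul, Ideal.mul_top, ← List.map_take, hspan, List.getElem_map,
      List.getElem_finRange]
    rw [isSMulRegular_quotient_iff_mem_of_smul_mem]
    intro p hp
    rw [mem_ideal_span_X_image] at hp ⊢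
    intro s hs
    obtain ⟨j, hj, hsj⟩ := hp (Finsupp.single ⟨i, hid⟩ 1 + s) (by
      rw [mem_support_iff] at hs ⊢
      simpa [coeff_X_mul'] using hs)
    refine ⟨j, hj, ?_⟩
    have hij : (⟨i, hid⟩ : Fin d) ≠ j := by
      rintro rfl
      obtain ⟨l, hl, hl'⟩ := List.mem_iff_getElem.1 hj
      simp at hl hl'
      omega
    simpa [Finsupp.single_apply, hij] using hsj
  · rw [smul_eq_mul, Ideal.mul_top, hspan] at h
    have h1 : (1 : MvPolynomial (Fin d) k) ∈
        Ideal.span (X '' {i | i ∈ List.finRange d} : Set (MvPolynomial (Fin d) k)) := h ▸ trivial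
    rw [mem_ideal_span_X_image] at h1
    obtain ⟨j, -, hj⟩ := h1 0 (by simp)
    exact hj rfl

theorem MvPolynomial.IsHomogeneous.mem_idealOfVars {p : MvPolynomial (Fin d) k} {e : ℕ}
    (hp : p.IsHomogeneous e) (he : 1 ≤ e) : p ∈ Ideal.span (Set.range X) := by
  rw [← Set.image_univ, mem_ideal_span_X_image]
  intro s hs
  by_contra! h
  have hs0 : s = 0 := Finsupp.ext fun i => h i trivial
  have := hp (mem_support_iff.1 hs)
  rw [hs0] at this
  simp at this
  omega

theorem one_notMem_span_range_X :
    (1 : MvPolynomial (Fin d) k) ∉ Ideal.span (Set.range X) := by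
  rw [← Set.image_univ, mem_ideal_span_X_image]
  intro h
  obtain ⟨j, -, hj⟩ := h 0 (by simp)
  exact hj rfl

theorem smul_top_quotient_ne_top {A : Type*} [CommRing A] {𝔞 J : Ideal A} (hJ : J ≤ 𝔞)
    (h𝔞 : 1 ∉ 𝔞) : 𝔞 • (⊤ : Submodule A (A ⧸ J)) ≠ ⊤ := by
  intro h
  have h1 : Submodule.mkQ J 1 ∈ 𝔞 • (⊤ : Submodule A (A ⧸ J)) := by
    rw [h]
    trivial
  rw [← Submodule.range_mkQ J, ← Submodule.map_top, ← Submodule.map_smul''] at h1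
  obtain ⟨y, hy, hy1⟩ := h1
  rw [smul_eq_mul, Ideal.mul_top] at hy
  have hJ1 : y - 1 ∈ J := (Submodule.Quotient.eq J).1 hy1
  exact h𝔞 (by simpa using 𝔞.sub_mem hy (hJ hJ1))

theorem extVanishesBelow_mvPolynomial :
    ExtVanishesBelow (ModuleCat.of (MvPolynomial (Fin d) k)
      (Shrink.{u} (MvPolynomial (Fin d) k ⧸
        Ideal.span (Set.range (X : Fin d → MvPolynomial (Fin d) k))))) d
      (MvPolynomial (Fin d) k) := by
  refine (exists_isRegular_iff_extVanishesBelow _ d _ fun h =>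
    one_notMem_span_range_X (k := k) (d := d) ?_).1
    ⟨_, fun x hx => ?_, isRegular_finRange_X, by simp⟩
  · rw [smul_eq_mul, Ideal.mul_top] at h
    exact h ▸ trivial
  · obtain ⟨i, -, rfl⟩ := List.mem_map.1 hx
    exact Ideal.subset_span ⟨i, rfl⟩

end MainTheorem

section RowBlocks

variable {A : Type*} [CommRing A] {m : ℕ} {ι κ : Type*} {φ : Matrix (Fin (m + 1)) (Fin m) A}
  (e : ι ⊕ κ ≃ Fin (m + 1))

theorem ker_mulVecLin_submatrix_inf_ker (φ : Matrix (Fin (m + 1)) (Fin m) A) :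
    LinearMap.ker (φ.submatrix (e ∘ Sum.inl) id).mulVecLin ⊓
      LinearMap.ker (φ.submatrix (e ∘ Sum.inr) id).mulVecLin = LinearMap.ker φ.mulVecLin := by
  ext v
  simp only [Submodule.mem_inf, LinearMap.mem_ker, funext_iff, ← e.forall_congr_right (q := _),
    Sum.forall]
  rfl

variable [Fintype ι] [Fintype κ]

theorem rowMap_eq_add {μ : Type*} [Fintype μ] (e : ι ⊕ κ ≃ μ) (g x : μ → A) :
    rowMap g x = rowMap (g ∘ e ∘ Sum.inl) (x ∘ e ∘ Sum.inl) +
      rowMap (g ∘ e ∘ Sum.inr) (x ∘ e ∘ Sum.inr) := by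
  simp only [rowMap_apply, ← e.sum_comp (fun i => g i * x i), Fintype.sum_sum_type,
    Function.comp_apply]

variable [IsDomain A] [IsNoetherianRing A] [UniqueFactorizationMonoid A]

theorem ker_rowMap_signedMinor_inl
    (hI : 2 ≤ idealHeight (Ideal.span (Set.range (signedMinor φ)))) :
    LinearMap.ker (rowMap (signedMinor φ ∘ e ∘ Sum.inl)) =
      (LinearMap.ker (φ.submatrix (e ∘ Sum.inr) id).mulVecLin).map
        (φ.submatrix (e ∘ Sum.inl) id).mulVecLin := by
  apply le_antisymm
  · intro c hc
    have hx : Sum.elim c 0 ∘ e.symm ∈ LinearMap.ker (rowMap (signedMinor φ)) := by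
      rw [LinearMap.mem_ker] at hc ⊢
      rw [rowMap_eq_add e]
      convert add_zero (0 : A) using 2
      · rw [← hc]
        congr 1
        ext i
        simp
      · convert map_zero (rowMap (signedMinor φ ∘ e ∘ Sum.inr)) using 2
        ext i
        simp
    rw [← range_mulVecLin_eq_ker_rowMap hI] at hx
    obtain ⟨v, hv⟩ := hx
    refine ⟨v, ?_, ?_⟩
    · ext j
      exact (congrFun hv (e (Sum.inr j))).trans (by simp)
    · ext i
      exact (congrFun hv (e (Sum.inl i))).trans (by simp)
  · rintro _ ⟨v, hv, rfl⟩
    have h := rowMap_signedMinor_mulVec φ v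
    rw [rowMap_eq_add e] at h
    have h0 : (φ *ᵥ v) ∘ e ∘ Sum.inr = 0 := hv
    rw [h0, map_zero, add_zero] at h
    exact h

theorem mem_of_mul_signedMinor_mem_span
    (hI : 2 ≤ idealHeight (Ideal.span (Set.range (signedMinor φ)))) {𝔞 : Ideal A} {j : κ}
    (hφ : ∀ l, φ (e (Sum.inr j)) l ∈ 𝔞) {r : A}
    (hr : r * signedMinor φ (e (Sum.inr j)) ∈
      Ideal.span (Set.range (signedMinor φ ∘ e ∘ Sum.inl))) : r ∈ 𝔞 := by
  classical
  rw [← range_rowMap] at hr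
  obtain ⟨c, hc⟩ := hr
  have hx : Sum.elim (-c) (Pi.single j r) ∘ e.symm ∈ LinearMap.ker (rowMap (signedMinor φ)) := by
    rw [LinearMap.mem_ker, rowMap_eq_add e]
    have h₁ : (Sum.elim (-c) (Pi.single j r) ∘ e.symm) ∘ e ∘ Sum.inl = -c := by
      ext i
      simp
    have h₂ : (Sum.elim (-c) (Pi.single j r) ∘ e.symm) ∘ e ∘ Sum.inr = Pi.single j r := by
      ext i
      simp
    rw [h₁, h₂, map_neg, hc, rowMap_apply, Finset.sum_eq_single j] <;>
      simp +contextual [mul_comm]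
  rw [← range_mulVecLin_eq_ker_rowMap hI] at hx
  obtain ⟨v, hv⟩ := hx
  have h := congrFun hv (e (Sum.inr j))
  simp only [Function.comp_apply, Equiv.symm_apply_apply, Sum.elim_inr, Pi.single_eq_same] at h
  rw [← h, Matrix.mulVecLin_apply, Matrix.mulVec_eq_sum, Finset.sum_apply]
  exact 𝔞.sum_mem fun l _ => 𝔞.mul_mem_right _ (hφ l)

end RowBlocks

theorem signedMinor_mem {A : Type*} [CommRing A] {m : ℕ} (hm : 1 ≤ m)
    {φ : Matrix (Fin (m + 1)) (Fin m) A} {𝔞 : Ideal A} (hφ : ∀ i l, φ i l ∈ 𝔞)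
    (i : Fin (m + 1)) : signedMinor φ i ∈ 𝔞 := by
  refine 𝔞.mul_mem_left _ ?_
  rw [Matrix.det_apply]
  refine 𝔞.sum_mem fun σ _ => Submodule.smul_of_tower_mem _ _ ?_
  exact 𝔞.mem_of_dvd (Finset.dvd_prod_of_mem _ (Finset.mem_univ ⟨0, hm⟩)) (hφ _ _)

section DepthOfSubmodule

universe u

variable {A : Type u} [CommRing A]

theorem ExtVanishesBelow.mono {K : ModuleCat.{u} A} {n n' : ℕ} {M : Type u} [AddCommGroup M]
    [Module A M] (h : ExtVanishesBelow K n M) (hn : n' ≤ n) : ExtVanishesBelow K n' M :=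
  fun i hi => h i (hi.trans_le hn)

theorem length_le_of_isRegular [IsNoetherianRing A] {M : Type*} [AddCommGroup M] [Module A M]
    [Module.Finite A M] {J : Ideal A} {h n : ℕ} (hJ : h ≤ idealHeight J)
    (hM : J ≤ Module.annihilator A M) (hdim : ringKrullDim A ≤ (n : WithBot ℕ∞))
    {rs : List A} (hrs : RingTheory.Sequence.IsRegular M rs) : rs.length + h ≤ n := by
  have h₁ := supportDim_add_length_le hrs
  have h₂ := (add_le_add_left h₁ (h : WithBot ℕ∞)).trans
    ((supportDim_add_le_ringKrullDim hJ hM).trans hdim)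
  exact_mod_cast h₂

theorem moduleDepth_quotient_eq_of_extVanishesBelow [IsNoetherianRing A] {𝔞 I J : Ideal A}
    (hJI : J ≤ I) {h n : ℕ} (hJ : h ≤ idealHeight J)
    (hdim : ringKrullDim A ≤ (n : WithBot ℕ∞))
    (hM : 𝔞 • (⊤ : Submodule A (A ⧸ J)) ≠ ⊤)
    (hN : 𝔞 • (⊤ : Submodule A (Submodule.restrictScalars A (I.map (Ideal.Quotient.mk J)))) ≠ ⊤)
    (hQ : ExtVanishesBelow (ModuleCat.of A (Shrink.{u} (A ⧸ 𝔞))) (n - h) (A ⧸ I)) :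
    moduleDepth 𝔞 (A ⧸ J) =
      moduleDepth 𝔞 (Submodule.restrictScalars A (I.map (Ideal.Quotient.mk J))) := by
  set N := Submodule.restrictScalars A (I.map (Ideal.Quotient.mk J)) with hNdef
  have hannM : J ≤ Module.annihilator A (A ⧸ J) := (Ideal.annihilator_quotient (I := J)).ge
  have hannN : J ≤ Module.annihilator A N :=
    hannM.trans (N.subtype.annihilator_le_of_injective N.injective_subtype)
  have hexact : Function.Exact N.subtype (Submodule.factor hJI) := by
    intro x
    obtain ⟨y, rfl⟩ := Ideal.Quotient.mk_surjective x
    have hy : Submodule.factor hJI (Ideal.Quotient.mk J y) = 0 ↔ y ∈ I :=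
      Ideal.Quotient.eq_zero_iff_mem
    rw [hy, ← Ideal.mem_quotient_iff_mem hJI]
    simp [hNdef]
  have key (r : ℕ) :
      (∃ rs : List A, (∀ x ∈ rs, x ∈ 𝔞) ∧ RingTheory.Sequence.IsRegular (A ⧸ J) rs ∧
          rs.length = r) ↔
        ∃ rs : List A, (∀ x ∈ rs, x ∈ 𝔞) ∧ RingTheory.Sequence.IsRegular N rs ∧
          rs.length = r := by
    constructor
    · intro hr
      have hrn : r + h ≤ n := by
        obtain ⟨rs, -, hrs, rfl⟩ := hr
        exact length_le_of_isRegular hJ hannM hdim hrs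
      rw [exists_isRegular_iff_extVanishesBelow _ _ _ hM] at hr
      rw [exists_isRegular_iff_extVanishesBelow _ _ _ hN]
      exact .left hexact N.injective_subtype (Submodule.factor_surjective hJI) hr
        (hQ.mono (by lia))
    · intro hr
      have hrn : r + h ≤ n := by
        obtain ⟨rs, -, hrs, rfl⟩ := hr
        exact length_le_of_isRegular hJ hannN hdim hrs
      rw [exists_isRegular_iff_extVanishesBelow _ _ _ hN] at hr
      rw [exists_isRegular_iff_extVanishesBelow _ _ _ hM]
      exact .middle hexact N.injective_subtype (Submodule.factor_surjective hJI) hr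
        (hQ.mono (by lia))
  unfold moduleDepth
  congr 1
  ext c
  induction c using ENat.recTopCoe with
  | top => simp
  | coe r => simpa using key r

theorem extVanishesBelow_quotient_of_range_eq_ker {K : ModuleCat.{u} A} {n m : ℕ}
    (hA : ExtVanishesBelow K (n + 2) A) {φ : Matrix (Fin (m + 1)) (Fin m) A}
    {g : Fin (m + 1) → A} (hφ : Function.Injective φ.mulVecLin)
    (hg : LinearMap.range φ.mulVecLin = LinearMap.ker (rowMap g)) :
    ExtVanishesBelow K n (A ⧸ LinearMap.range (rowMap g)) := by
  have hI : ExtVanishesBelow K (n + 1) (LinearMap.range (rowMap g)) := by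
    refine .right (f := φ.mulVecLin) (g := (rowMap g).rangeRestrict) ?_ hφ
      (rowMap g).surjective_rangeRestrict (hA.pi m) ((hA.pi (m + 1)).mono (by lia))
    rw [LinearMap.exact_iff, LinearMap.ker_rangeRestrict, hg]
  exact .right (LinearMap.exact_subtype_mkQ _) (Submodule.injective_subtype _)
    (Submodule.mkQ_surjective _) hI (hA.mono (by lia))

end DepthOfSubmodule

/-- Let `φ = [Φ₁; Φ₂]` be an `n×(n−1)` matrix over `R = k[x_1,…,x_d]` with
`ht I_{n−1}(φ) = 2`, let `f_1,…,f_a` be the signed maximal minors of `φ` fixing the rows of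
`Φ₂`, `J = (f_1,…,f_a)` of height 2, and let `ψ₁, ψ₂` be maps of free modules with
`Im ψ₁ = ker Φ₂` and `Im ψ₂ = ker ψ₁`.  Then (1) the kernel of the row map `R^a → R` given
by `(f_1,…,f_a)` equals the image of `Φ₁∘ψ₁`, and (2) `ker(Φ₁∘ψ₁) = Im ψ₂`.  Consequently a
free resolution of `I/J` (presented by `Φ₂`) yields a free resolution of `R/J`, and
`depth R/J = depth I/J`.  (Here `n = m + 1`.) -/
theorem statement5 {k : Type*} [Field k] [Infinite k] {d m a : ℕ}
    (hd : 1 ≤ d) (ha : 1 ≤ a) (ham : a ≤ m) (ε₁ ε₂ : ℕ) (hε₂ : 1 ≤ ε₂) (hε : ε₂ ≤ ε₁)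
    (φ : Matrix (Fin (m + 1)) (Fin m) (MvPolynomial (Fin d) k))
    (Φ₁ : Matrix (Fin a) (Fin m) (MvPolynomial (Fin d) k))
    (Φ₂ : Matrix (Fin (m + 1 - a)) (Fin m) (MvPolynomial (Fin d) k))
    (hΦ₁ : Φ₁ = φ.submatrix (fun i : Fin a =>
      (⟨(i : ℕ), by have := i.isLt; omega⟩ : Fin (m + 1))) id)
    (hΦ₂ : Φ₂ = φ.submatrix (fun i : Fin (m + 1 - a) =>
      (⟨a + (i : ℕ), by have := i.isLt; omega⟩ : Fin (m + 1))) id)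
    (hdeg₁ : ∀ i j, (Φ₁ i j).IsHomogeneous ε₁)
    (hdeg₂ : ∀ i j, (Φ₂ i j).IsHomogeneous ε₂)
    (hI : idealHeight (minorsIdeal m φ) = 2)
    (f : Fin a → MvPolynomial (Fin d) k)
    (hf : f = fun i : Fin a => (-1) ^ (i : ℕ) *
      (φ.submatrix (Fin.succAbove (⟨(i : ℕ), by have := i.isLt; omega⟩ : Fin (m + 1))) id).det)
    (J : Ideal (MvPolynomial (Fin d) k)) (hJ : J = Ideal.span (Set.range f))
    (hJht : idealHeight J = 2)
    (mI : Ideal (MvPolynomial (Fin d) k))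
    (hmI : mI = Ideal.span (Set.range (MvPolynomial.X : Fin d → MvPolynomial (Fin d) k))) :
    (∀ (p q : ℕ)
      (ψ₁ : (Fin p → MvPolynomial (Fin d) k) →ₗ[MvPolynomial (Fin d) k]
        (Fin m → MvPolynomial (Fin d) k))
      (ψ₂ : (Fin q → MvPolynomial (Fin d) k) →ₗ[MvPolynomial (Fin d) k]
        (Fin p → MvPolynomial (Fin d) k)),
      LinearMap.range ψ₁ = LinearMap.ker Φ₂.mulVecLin →
      LinearMap.range ψ₂ = LinearMap.ker ψ₁ →
        LinearMap.ker (rowMap f) = LinearMap.range (Φ₁.mulVecLin ∘ₗ ψ₁) ∧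
        LinearMap.ker (Φ₁.mulVecLin ∘ₗ ψ₁) = LinearMap.range ψ₂) ∧
    moduleDepth mI (MvPolynomial (Fin d) k ⧸ J) =
      moduleDepth mI (↥(Submodule.restrictScalars (MvPolynomial (Fin d) k)
        (Ideal.map (Ideal.Quotient.mk J) (minorsIdeal m φ)))) := by
  subst hJ hmI
  let e : Fin a ⊕ Fin (m + 1 - a) ≃ Fin (m + 1) :=
    finSumFinEquiv.trans (finCongr (by omega))
  obtain rfl : Φ₁ = φ.submatrix (e ∘ Sum.inl) id := hΦ₁
  obtain rfl : Φ₂ = φ.submatrix (e ∘ Sum.inr) id := hΦ₂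
  obtain rfl : f = signedMinor φ ∘ e ∘ Sum.inl := hf
  rw [← span_signedMinor] at hI ⊢
  have hinj : Function.Injective φ.mulVecLin := by
    obtain ⟨i, hi⟩ := exists_ne_zero_of_two_le_idealHeight hI.ge
    exact mulVec_injective_of_signedMinor_ne_zero hi
  refine ⟨fun p q ψ₁ ψ₂ h₁ h₂ => ⟨?_, ?_⟩, ?_⟩
  · rw [LinearMap.range_comp, h₁, ker_rowMap_signedMinor_inl e hI.ge]
  · rw [h₂]
    refine le_antisymm (fun w hw => ?_) (LinearMap.ker_le_ker_comp _ _)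
    have hw' : ψ₁ w ∈ LinearMap.ker φ.mulVecLin := by
      rw [← ker_mulVecLin_submatrix_inf_ker e]
      exact ⟨hw, h₁ ▸ LinearMap.mem_range_self ψ₁ w⟩
    rwa [LinearMap.ker_eq_bot.2 hinj] at hw'
  set 𝔪 : Ideal (MvPolynomial (Fin d) k) := Ideal.span (Set.range X)
  have hbot (j l) : φ (e (Sum.inr j)) l ∈ 𝔪 := (hdeg₂ j l).mem_idealOfVars hε₂
  have hφ (i l) : φ i l ∈ 𝔪 := by
    obtain ⟨i | j, rfl⟩ := e.surjective i
    · exact (hdeg₁ i l).mem_idealOfVars (hε₂.trans hε)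
    · exact hbot j l
  set J := Ideal.span (Set.range (signedMinor φ ∘ e ∘ Sum.inl))
  set I := Ideal.span (Set.range (signedMinor φ)) with hIdef
  have hJI : J ≤ I := Ideal.span_mono (Set.range_comp_subset_range _ _)
  have hJm : J ≤ 𝔪 :=
    Ideal.span_le.2 (Set.range_subset_iff.2 fun i => signedMinor_mem (ha.trans ham) hφ _)
  have hdim : ringKrullDim (MvPolynomial (Fin d) k) ≤ ((d : ℕ) : WithBot ℕ∞) := by
    simp [MvPolynomial.ringKrullDim_of_isNoetherianRing, ringKrullDim_eq_zero_of_field]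
  have hM := smul_top_quotient_ne_top hJm one_notMem_span_range_X
  have hN : 𝔪 • (⊤ : Submodule (MvPolynomial (Fin d) k)
      (Submodule.restrictScalars (MvPolynomial (Fin d) k) (I.map (Ideal.Quotient.mk J)))) ≠ ⊤ := by
    intro h
    obtain ⟨r, hr, hr'⟩ := Submodule.exists_sub_one_mem_and_smul_eq_zero_of_fg_of_le_smul 𝔪 ⊤
      Module.Finite.fg_top h.ge
    let j : Fin (m + 1 - a) := ⟨0, by omega⟩
    have hrm : r ∈ 𝔪 := by
      refine mem_of_mul_signedMinor_mem_span e hI.ge (hbot j) ?_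
      have := hr' ⟨Ideal.Quotient.mk J (signedMinor φ (e (Sum.inr j))),
        Ideal.mem_map_of_mem _ (Ideal.subset_span ⟨_, rfl⟩)⟩ trivial
      exact Ideal.Quotient.eq_zero_iff_mem.1 (congrArg Subtype.val this)
    exact one_notMem_span_range_X (by simpa using 𝔪.sub_mem hrm hr)
  have hd2 : 2 ≤ d := by
    have hnil : RingTheory.Sequence.IsRegular (MvPolynomial (Fin d) k ⧸ J)
        ([] : List (MvPolynomial (Fin d) k)) := by
      have : J ≠ ⊤ := fun h => one_notMem_span_range_X (hJm (h ▸ trivial))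
      have : Nontrivial (MvPolynomial (Fin d) k ⧸ J) := Ideal.Quotient.nontrivial_iff.2 this
      exact RingTheory.Sequence.IsRegular.nil (MvPolynomial (Fin d) k) _
    simpa using length_le_of_isRegular (A := MvPolynomial (Fin d) k) (h := 2) hJht.ge
      (Ideal.annihilator_quotient (I := J)).ge hdim hnil
  refine moduleDepth_quotient_eq_of_extVanishesBelow hJI (h := 2) hJht.ge hdim hM hN ?_
  rw [hIdef, ← range_rowMap]
  exact extVanishesBelow_quotient_of_range_eq_ker (extVanishesBelow_mvPolynomial.mono (by omega))
    hinj (range_mulVecLin_eq_ker_rowMap hI.ge)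
end

section
/- Let R = k[x_1,…,x_d] be a standard graded polynomial ring over a field and let ψ : R(−δ)^s → R^{s−2} be a graded map given by an (s−2)×s matrix of forms of degree δ, with ht I_{s−2}(ψ) = 3. Let θ be the s×s skew-symmetric matrix whose nonzero entries in the j-th column are the ordered signed (s−2)-minors of the submatrix of ψ obtained by omitting its j-th column. Then the complex 0 → R(−4δ)^{s−2} →^{ψᵗ} R(−3δ)^s →^{θ} R(−δ)^s →^{ψ} R^{s−2} → coker ψ → 0 is exact, giving the minimal graded free resolution of M = coker ψ. Moreover, for a row vector of indeterminates T = (T_1,…,T_s) over R one has the matrix identity T·θ = (Δ_1,…,Δ_s), where Δ_1,…,Δ_s are the ordered signed (s−1)-minors of the s×(s−1) matrix [Tᵗ | ψᵗ]. -/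
open Matrix MvPolynomial

/-- The shear `X₀ ↦ X₀`, `Xᵢ ↦ Xᵢ + c X₀ ^ N ^ i` of a polynomial ring. -/
noncomputable def powerShear {k : Type*} [CommRing k] {n : ℕ} (N : ℕ) (c : k) :
    MvPolynomial (Fin (n + 1)) k →ₐ[k] MvPolynomial (Fin (n + 1)) k :=
  aeval fun i ↦ if i = 0 then X 0 else X i + c • X 0 ^ N ^ (i : ℕ)

lemma powerShear_comp_neg {k : Type*} [CommRing k] {n : ℕ} (N : ℕ) (c : k) :
    (powerShear (n := n) N c).comp (powerShear N (-c)) = AlgHom.id _ _ := by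
  unfold powerShear
  rw [comp_aeval, ← MvPolynomial.aeval_X_left]
  ext i v
  cases i using Fin.cases <;> simp

/-- The shear `powerShear N 1`, as an isomorphism onto the polynomial ring in the
variable `X₀` over the polynomial ring in the remaining variables. -/
noncomputable def powerShearEquiv (k : Type*) [CommRing k] (n N : ℕ) :
    MvPolynomial (Fin (n + 1)) k ≃ₐ[k] Polynomial (MvPolynomial (Fin n) k) :=
  (AlgEquiv.ofAlgHom (powerShear N 1) (powerShear N (-1))
    (powerShear_comp_neg N 1) (by simpa using powerShear_comp_neg N (-1 : k))).trans
    (finSuccEquiv k n)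

lemma powerShearEquiv_X {k : Type*} [CommRing k] [Nontrivial k] {n N : ℕ} (hN : 0 < N)
    (i : Fin (n + 1)) :
    (powerShearEquiv k n N (X i)).Monic ∧
      (powerShearEquiv k n N (X i)).natDegree = N ^ (i : ℕ) := by
  cases i using Fin.cases with
  | zero => simp [powerShearEquiv, powerShear, finSuccEquiv_X_zero, Polynomial.monic_X]
  | succ i =>
    have h : powerShearEquiv k n N (X i.succ) =
        Polynomial.X ^ N ^ ((i.succ : Fin (n + 1)) : ℕ) + Polynomial.C (X i) := by
      simp [powerShearEquiv, powerShear, finSuccEquiv_X_zero, finSuccEquiv_X_succ, add_comm]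
    rw [h]
    exact ⟨Polynomial.monic_X_pow_add_C _ (pow_pos hN _).ne', Polynomial.natDegree_X_pow_add_C⟩

lemma powerShearEquiv_monomial {k : Type*} [CommRing k] [IsDomain k] {n N : ℕ} (hN : 0 < N)
    (v : Fin (n + 1) →₀ ℕ) {a : k} (ha : a ≠ 0) :
    (powerShearEquiv k n N (monomial v a)).leadingCoeff = C a ∧
      (powerShearEquiv k n N (monomial v a)).natDegree =
        ∑ i : Fin (n + 1), N ^ (i : ℕ) * v i := by
  have hmonic : ∀ i ∈ Finset.univ, (powerShearEquiv k n N (X i) ^ v i).Monic :=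
    fun i _ ↦ (powerShearEquiv_X hN i).1.pow _
  have h : powerShearEquiv k n N (monomial v a) =
      Polynomial.C (C a) * ∏ i, powerShearEquiv k n N (X i) ^ v i := by
    rw [monomial_eq, Finsupp.prod_fintype _ _ fun i ↦ pow_zero _]
    simp only [map_mul, map_prod, map_pow]
    congr 1
    simp [powerShearEquiv, powerShear, finSuccEquiv_apply, MvPolynomial.algebraMap_eq]
  have hp := Polynomial.monic_prod_of_monic _ _ hmonic
  rw [h]
  constructor
  · rw [Polynomial.leadingCoeff_mul_monic hp, Polynomial.leadingCoeff_C]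
  · rw [Polynomial.natDegree_C_mul (by simpa using ha),
      Polynomial.natDegree_prod_of_monic _ _ hmonic]
    refine Finset.sum_congr rfl fun i _ ↦ ?_
    rw [(powerShearEquiv_X hN i).1.natDegree_pow, (powerShearEquiv_X hN i).2, mul_comm]

lemma sum_pow_mul_injOn (n : ℕ) {N : ℕ} (hN : 1 < N) :
    Set.InjOn (fun v : Fin n →₀ ℕ ↦ ∑ i : Fin n, N ^ (i : ℕ) * v i) {v | ∀ i, v i < N} := by
  intro v hv w hw h
  refine Finsupp.ext <| congrFun <| List.ofFn_inj.mp ?_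
  apply Nat.ofDigits_inj_of_len_eq hN (by simp)
  · simpa [List.mem_ofFn] using hv
  · simpa [List.mem_ofFn] using hw
  · simpa only [Nat.ofDigits_eq_sum_mapIdx, List.mapIdx_eq_ofFn, List.get_ofFn, List.length_ofFn,
      Fin.val_cast, mul_comm, List.sum_ofFn] using! h

lemma exists_powerShearEquiv_isUnit_leadingCoeff {k : Type*} [Field k] {n : ℕ}
    {f : MvPolynomial (Fin (n + 1)) k} (hf : f ≠ 0) :
    ∃ N, IsUnit (powerShearEquiv k n N f).leadingCoeff := by
  set N := 2 + f.totalDegree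
  have hN : 0 < N := by omega
  set h := fun v ↦ powerShearEquiv k n N (monomial v (coeff v f))
  have hlt : ∀ v ∈ f.support, ∀ i, v i < N := fun v hv i ↦
    lt_of_le_of_lt ((monomial_le_degreeOf i hv).trans (degreeOf_le_totalDegree f i)) (by omega)
  have hinj := (sum_pow_mul_injOn (n + 1) (N := N) (by omega)).mono hlt
  obtain ⟨v, vin, vs⟩ := Finset.exists_max_image f.support (fun v ↦ ∑ i : Fin (n + 1), N ^ (i : ℕ) * v i)
    (support_nonempty.mpr hf)
  have hne : ∀ w ∈ f.support, h w ≠ 0 := fun w hw ↦ by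
    simpa [h] using mem_support_iff.mp hw
  have hdeg : ∀ w ∈ f.support.erase v, (h w).degree < (h v).degree := by
    intro w hw
    obtain ⟨hwv, hw⟩ := Finset.mem_erase.mp hw
    rw [Polynomial.degree_eq_natDegree (hne w hw), Polynomial.degree_eq_natDegree (hne v vin),
      (powerShearEquiv_monomial hN w (mem_support_iff.mp hw)).2,
      (powerShearEquiv_monomial hN v (mem_support_iff.mp vin)).2]
    exact_mod_cast lt_of_le_of_ne (vs w hw) fun e ↦ hwv (hinj hw vin e)
  have hsum : powerShearEquiv k n N f = ∑ w ∈ f.support.erase v, h w + h v := by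
    rw [Finset.sum_erase_add _ _ vin]
    conv_lhs => rw [← f.support_sum_monomial_coeff, map_sum]
  refine ⟨N, ?_⟩
  rw [hsum, Polynomial.leadingCoeff_add_of_degree_lt,
    (powerShearEquiv_monomial hN v (mem_support_iff.mp vin)).1]
  · exact (mem_support_iff.mp vin).isUnit.map C
  · refine (Polynomial.degree_sum_le _ _).trans_lt ?_
    exact (Finset.sup_lt_iff (Ne.bot_lt fun e ↦ hne v vin (Polynomial.degree_eq_bot.mp e))).mpr hdeg

attribute [local instance] Polynomial.algebra in
lemma height_le_one_of_comap_C_eq_bot {D : Type*} [CommRing D] [IsDomain D]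
    (P : Ideal (Polynomial D)) [P.IsPrime] (h : P.comap Polynomial.C = ⊥) : P.height ≤ 1 := by
  let K := FractionRing D
  have hloc := Polynomial.isLocalization (nonZeroDivisors D) K
  have hd : Disjoint (((nonZeroDivisors D).map Polynomial.C : Submonoid (Polynomial D)) :
      Set (Polynomial D)) P := by
    refine Set.disjoint_left.mpr ?_
    rintro _ ⟨x, hx, rfl⟩ hP
    have : x ∈ P.comap Polynomial.C := hP
    rw [h] at this
    exact nonZeroDivisors.ne_zero hx this
  rw [← IsLocalization.height_map_of_disjoint _ (S := Polynomial K) P hd]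
  have := IsLocalization.isPrime_of_isPrime_disjoint _ (Polynomial K) P ‹_› hd
  have h1 : ((P.map (algebraMap _ (Polynomial K))).height : WithBot ℕ∞) ≤ 1 := by
    refine Ideal.height_le_ringKrullDim_of_isPrime.trans ?_
    rw [Polynomial.ringKrullDim_of_isNoetherianRing, ringKrullDim_eq_zero_of_field, zero_add]
  exact_mod_cast h1

lemma height_le_height_comap_C_add_one {B : Type*} [CommRing B] [IsNoetherianRing B]
    (P : Ideal (Polynomial B)) [P.IsPrime] : P.height ≤ (P.comap Polynomial.C).height + 1 := by
  set Q := P.comap Polynomial.C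
  have : P.LiesOver Q := ⟨rfl⟩
  refine (Ideal.height_le_height_add_of_liesOver Q P).trans ?_
  gcongr
  let e : (Polynomial B ⧸ (Q.map (algebraMap B (Polynomial B)))) ≃+* Polynomial (B ⧸ Q) :=
    (Ideal.polynomialQuotientEquivQuotientPolynomial Q).symm
  have hP' : (P.map (Ideal.Quotient.mk (Q.map (algebraMap B (Polynomial B))))).IsPrime := by
    refine Ideal.map_isPrime_of_surjective Ideal.Quotient.mk_surjective ?_
    rw [Ideal.mk_ker]
    exact Ideal.map_comap_le
  rw [← RingEquiv.height_map e]
  have := Ideal.map_isPrime_of_equiv e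
    (I := P.map (Ideal.Quotient.mk (Q.map (algebraMap B (Polynomial B)))))
  refine height_le_one_of_comap_C_eq_bot _ ?_
  rw [eq_bot_iff]
  intro x hx
  obtain ⟨b, rfl⟩ := Ideal.Quotient.mk_surjective x
  rw [Ideal.mem_comap] at hx
  have hb : Polynomial.C (Ideal.Quotient.mk Q b) =
      e (Ideal.Quotient.mk _ (Polynomial.C b)) := by
    change _ = (Ideal.polynomialQuotientEquivQuotientPolynomial Q).symm
      (Ideal.Quotient.mk (Q.map Polynomial.C) (Polynomial.C b))
    rw [Ideal.polynomialQuotientEquivQuotientPolynomial_symm_mk]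
    simp
  rw [hb] at hx
  have hx' : Ideal.Quotient.mk (Q.map (algebraMap B (Polynomial B))) (Polynomial.C b) ∈
      P.map (Ideal.Quotient.mk (Q.map (algebraMap B (Polynomial B)))) := by
    obtain ⟨y, hy, hye⟩ := (Ideal.mem_map_iff_of_surjective _ e.surjective).mp hx
    rwa [← e.injective hye]
  exact Ideal.Quotient.eq_zero_iff_mem.mpr
    (show b ∈ Q from (Ideal.mem_quotient_iff_mem (Ideal.map_comap_le (K := P))).mp hx')

lemma le_height_comap_C_of_monic_mem {B : Type*} [CommRing B] [IsNoetherianRing B]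
    {J : Ideal (Polynomial B)} {g : Polynomial B} (hg : g.Monic) (hgJ : g ∈ J) {r : ℕ}
    (hr : ((r + 1 : ℕ) : ℕ∞) ≤ J.height) : (r : ℕ∞) ≤ (J.comap Polynomial.C).height := by
  rw [Ideal.height_eq_inf_minimalPrimes]
  refine le_iInf₂ fun Q hQ ↦ ?_
  have := hQ.isPrime
  have hint : Algebra.IsIntegral B (Polynomial B ⧸ J) :=
    ⟨hg.quotient_isIntegral hgJ⟩
  obtain ⟨P', -, hP', hPQ⟩ := Ideal.exists_ideal_over_prime_of_isIntegral (S := Polynomial B ⧸ J)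
    Q ⊥ (fun x hx ↦ hQ.1.2 (show Polynomial.C x ∈ J from Ideal.Quotient.eq_zero_iff_mem.mp hx))
  let P := P'.comap (Ideal.Quotient.mk J)
  have hJP : J ≤ P := fun x hx ↦ by
    simp [P, Ideal.mem_comap, Ideal.Quotient.eq_zero_iff_mem.mpr hx]
  have hPC : P.comap Polynomial.C = Q := hPQ
  have h := (hr.trans (Ideal.height_mono hJP)).trans (height_le_height_comap_C_add_one P)
  rw [hPC, Nat.cast_add, Nat.cast_one] at h
  exact (ENat.add_le_add_iff_right ENat.one_ne_top).mp h

open RingTheory.Sequence in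
lemma isWeaklyRegular_monic_cons_map_C {B : Type*} [CommRing B] {g : Polynomial B}
    (hg : g.Monic) {rs : List B} (hrs : IsWeaklyRegular B rs) :
    IsWeaklyRegular (Polynomial B) (g :: rs.map Polynomial.C) := by
  refine IsWeaklyRegular.cons (fun x y h ↦ hg.isRegular.left h) ?_
  have := hg.free_quotient
  have h := hrs.isWeaklyRegular_lTensor (M₂ := Polynomial B ⧸ Ideal.span {g})
  rw [(TensorProduct.rid B _).isWeaklyRegular_congr,
    ← isWeaklyRegular_map_algebraMap_iff (Polynomial B)] at h
  exact ((Submodule.quotEquivOfEq _ _ (by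
    rw [← Submodule.ideal_span_singleton_smul]; simp)).isWeaklyRegular_congr _).mp h

open RingTheory.Sequence in
/-- Over a field, an ideal of height at least `r` in a polynomial ring contains a weakly regular
sequence of length `r`. -/
theorem exists_isWeaklyRegular_of_le_height {k : Type*} [Field k] {d : ℕ} (r : ℕ)
    (I : Ideal (MvPolynomial (Fin d) k)) (hr : (r : ℕ∞) ≤ I.height) :
    ∃ rs : List (MvPolynomial (Fin d) k), (∀ x ∈ rs, x ∈ I) ∧ rs.length = r ∧
      IsWeaklyRegular (MvPolynomial (Fin d) k) rs := by
  induction d generalizing r with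
  | zero =>
    by_cases hI : I = ⊤
    · subst hI
      refine ⟨List.replicate r 1, by simp, by simp, ⟨fun i hi ↦ ?_⟩⟩
      simp only [List.getElem_replicate]
      exact IsSMulRegular.one _
    · have h0 : I.height ≤ 0 := by
        have := (Ideal.height_le_ringKrullDim_of_ne_top hI).trans_eq
          MvPolynomial.ringKrullDim_of_isNoetherianRing
        simpa using this
      obtain rfl : r = 0 := by exact_mod_cast nonpos_iff_eq_zero.mp (hr.trans h0)
      exact ⟨[], by simp, rfl, IsWeaklyRegular.nil _ _⟩
  | succ d ih =>
    cases r with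
    | zero => exact ⟨[], by simp, rfl, IsWeaklyRegular.nil _ _⟩
    | succ r =>
      have hI : I ≠ ⊥ := by
        rintro rfl
        simp at hr
      obtain ⟨f, hf, hf0⟩ := Submodule.exists_mem_ne_zero_of_ne_bot hI
      obtain ⟨N, hN⟩ := exists_powerShearEquiv_isUnit_leadingCoeff hf0
      let e := (powerShearEquiv k d N).symm.toRingEquiv
      let J := I.comap e
      set g := hN.unit⁻¹.val • powerShearEquiv k d N f
      have hg : g.Monic := Polynomial.monic_of_isUnit_leadingCoeff_inv_smul hN
      have hgJ : g ∈ J := by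
        refine Submodule.smul_of_tower_mem J _ ?_
        simpa [J, e, Ideal.mem_comap] using hf
      have hJ : J.height = I.height := RingEquiv.height_comap e I
      obtain ⟨rs, hrs, hlen, hreg⟩ := ih r _ (le_height_comap_C_of_monic_mem hg hgJ (hJ ▸ hr))
      refine ⟨(g :: rs.map Polynomial.C).map e, ?_, by simpa using hlen,
        (e.toAddEquiv.isWeaklyRegular_congr ?_).mp (isWeaklyRegular_monic_cons_map_C hg hreg)⟩
      · intro x hx
        obtain ⟨y, hy, rfl⟩ := List.mem_map.mp hx
        rcases List.mem_cons.mp hy with rfl | hy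
        · exact hgJ
        · obtain ⟨z, hz, rfl⟩ := List.mem_map.mp hy
          exact hrs z hz
      · exact List.forall₂_map_right_iff.mpr <| List.forall₂_same.mpr fun r _ x ↦ map_mul e r x

section BuchsbaumRim

variable {A : Type*} [CommRing A] {m : ℕ} (ψ : Matrix (Fin m) (Fin (m + 2)) A)

lemma bbrim_self (i : Fin (m + 2)) : bbrim ψ i i = 0 := by
  simp [bbrim]

lemma bbrim_swap (i j : Fin (m + 2)) : bbrim ψ j i = -bbrim ψ i j := by
  rcases lt_trichotomy (i : ℕ) j with h | h | h
  · simp only [bbrim, Matrix.of_apply, h, h.not_gt, dite_true, dite_false]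
    rw [pow_succ, add_comm (j : ℕ)]
    ring
  · rw [Fin.ext h, bbrim_self, neg_zero]
  · simp only [bbrim, Matrix.of_apply, h, h.not_gt, dite_true, dite_false]
    rw [pow_succ, add_comm (j : ℕ)]
    ring

lemma bbrim_transpose : (bbrim ψ)ᵀ = -bbrim ψ := by
  ext i j
  exact bbrim_swap ψ i j

lemma bbrim_succAbove (j : Fin (m + 2)) (i : Fin (m + 1)) :
    bbrim ψ (j.succAbove i) j = (-1) ^ ((j : ℕ) + i) *
      (ψ.submatrix id fun q ↦ j.succAbove (i.succAbove q)).det := by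
  rcases Nat.lt_or_ge i j with h | h
  · have hv : ((j.succAbove i : Fin (m + 2)) : ℕ) = i := by
      simp [Fin.succAbove, Fin.lt_def, h]
    have hv' : (⟨(j.succAbove i : Fin (m + 2)), by omega⟩ : Fin (m + 1)) = i := Fin.ext hv
    simp only [bbrim, Matrix.of_apply, hv, h, dite_true, add_comm (j : ℕ)]
  · have hv : j.succAbove i = i.succ := Fin.succAbove_of_le_castSucc _ _ h
    have h1 : ¬ ((i.succ : Fin (m + 2)) : ℕ) < j := by simp; omega
    have h2 : (j : ℕ) < (i.succ : Fin (m + 2)) := by simp; omega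
    have hcol : (fun q ↦ i.succ.succAbove
          ((⟨(j : ℕ), by have := i.isLt; omega⟩ : Fin (m + 1)).succAbove q)) =
        fun q ↦ j.succAbove (i.succAbove q) := by
      funext q
      rw [← Fin.succAbove_succAbove_succAbove_predAbove j i q, hv]
      congr 2
      rw [Fin.predAbove_of_le_castSucc _ _ h]
      rfl
    rw [hv]
    simp only [bbrim, Matrix.of_apply, h1, h2, dite_true, dite_false]
    rw [hcol, Fin.val_succ]
    ring

lemma sum_mul_bbrim (t : Fin (m + 2) → A) (j : Fin (m + 2)) :
    ∑ i, t i * bbrim ψ i j = (-1) ^ (j : ℕ) *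
      ((Matrix.of fun i (c : Fin (m + 1)) ↦
        (Fin.cases (t i) (fun c' ↦ ψ c' i) c : A)).submatrix j.succAbove id).det := by
  rw [Fin.sum_univ_succAbove _ j, bbrim_self, mul_zero, zero_add, Matrix.det_succ_column_zero,
    Finset.mul_sum]
  refine Finset.sum_congr rfl fun i _ ↦ ?_
  rw [bbrim_succAbove, ← Matrix.det_transpose (ψ.submatrix _ _), pow_add]
  have : (ψ.submatrix id fun q ↦ j.succAbove (i.succAbove q))ᵀ =
      ((Matrix.of fun i (c : Fin (m + 1)) ↦
        (Fin.cases (t i) (fun c' ↦ ψ c' i) c : A)).submatrix j.succAbove id).submatrix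
          i.succAbove Fin.succ := by
    ext a b
    simp
  rw [this]
  simp only [Matrix.submatrix_apply, Matrix.of_apply, id, Fin.cases_zero]
  ring

lemma mul_bbrim : ψ * bbrim ψ = 0 := by
  ext a j
  rw [Matrix.mul_apply, sum_mul_bbrim ψ (ψ a) j,
    Matrix.det_zero_of_column_eq (Fin.succ_ne_zero a).symm, mul_zero, Matrix.zero_apply]
  intro i
  simp

lemma bbrim_mul_transpose : bbrim ψ * ψᵀ = 0 := by
  have h := congrArg Matrix.transpose (mul_bbrim ψ)
  rwa [Matrix.transpose_mul, bbrim_transpose, Matrix.neg_mul, Matrix.transpose_zero,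
    neg_eq_zero] at h

lemma bbrim_map {B : Type*} [CommRing B] (f : A →+* B) :
    bbrim (ψ.map f) = (bbrim ψ).map f := by
  ext i j
  simp only [bbrim, Matrix.of_apply, Matrix.map_apply, apply_dite f, map_mul, map_pow, map_neg,
    map_one, map_zero, RingHom.map_det, RingHom.mapMatrix_apply, Matrix.submatrix_map]

lemma minorsIdeal_le {K : Ideal A}
    (hK : ∀ (j : Fin (m + 2)) (i : Fin (m + 1)), bbrim ψ (j.succAbove i) j ∈ K) :
    minorsIdeal m ψ ≤ K := by
  refine Ideal.span_le.mpr ?_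
  rintro _ ⟨r, c, hr, hc, rfl⟩
  have hnot : ∀ {n : ℕ} {f : Fin m → Fin n}, m < n → ∃ y, ∀ x, f x ≠ y := by
    intro n f hn
    by_contra! h
    exact absurd (Fintype.card_le_of_surjective f h) (by simpa using hn)
  obtain ⟨j, hj⟩ := hnot (f := c) (by omega)
  choose c' hc' using fun x ↦ Fin.exists_succAbove_eq (hj x)
  obtain ⟨i, hi⟩ := hnot (f := c') (by omega)
  choose s hs using fun x ↦ Fin.exists_succAbove_eq (hi x)
  have hcs : ∀ x, c x = j.succAbove (i.succAbove (s x)) := fun x ↦ by rw [hs, hc']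
  have hs_inj : Function.Injective s := fun x y h ↦ hc (by rw [hcs, hcs, h])
  let ρ := Equiv.ofBijective r (Finite.injective_iff_bijective.mp hr)
  let σ := Equiv.ofBijective s (Finite.injective_iff_bijective.mp hs_inj)
  have hdet : (ψ.submatrix r c).det = (Equiv.Perm.sign ρ : A) * ((Equiv.Perm.sign σ : A) *
      (ψ.submatrix id fun q ↦ j.succAbove (i.succAbove q)).det) := by
    rw [← Matrix.det_permute', ← Matrix.det_permute]
    congr 1
    ext a b
    simp [ρ, σ, hcs]
  have hmem := K.mul_mem_left ((-1) ^ ((j : ℕ) + i)) (hK j i)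
  rw [bbrim_succAbove, ← mul_assoc, ← mul_pow] at hmem
  rw [SetLike.mem_coe, hdet]
  exact K.mul_mem_left _ (K.mul_mem_left _ (by simpa using hmem))

variable {ψ}

lemma bbrim_smul_mem_range_transpose [IsDomain A] {w : Fin (m + 2) → A}
    (hw : bbrim ψ *ᵥ w = 0) (j : Fin (m + 2)) (i : Fin (m + 1)) :
    ∃ v, ψᵀ *ᵥ v = bbrim ψ (j.succAbove i) j • w := by
  set Δ := bbrim ψ (j.succAbove i) j with hΔ
  by_cases h0 : Δ = 0
  · exact ⟨0, by rw [h0, zero_smul, Matrix.mulVec_zero]⟩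
  set M := ψ.submatrix id fun q ↦ j.succAbove (i.succAbove q) with hM
  set w' : Fin m → A := fun q ↦ w (j.succAbove (i.succAbove q))
  set v := (-1 : A) ^ ((j : ℕ) + i) • (Mᵀ.adjugate *ᵥ w')
  refine ⟨v, ?_⟩
  set y := Δ • w - ψᵀ *ᵥ v with hy
  have hy_other : ∀ q, y (j.succAbove (i.succAbove q)) = 0 := by
    intro q
    have h : Mᵀ *ᵥ v = Δ • w' := by
      rw [Matrix.mulVec_smul, Matrix.mulVec_mulVec, Matrix.mul_adjugate, Matrix.smul_mulVec,
        Matrix.one_mulVec, smul_smul, Matrix.det_transpose, hΔ, bbrim_succAbove]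
    have h' : (ψᵀ *ᵥ v) (j.succAbove (i.succAbove q)) = (Mᵀ *ᵥ v) q := rfl
    rw [hy, Pi.sub_apply, h', h, Pi.smul_apply, Pi.smul_apply, sub_self]
  have hθy : bbrim ψ *ᵥ y = 0 := by
    rw [hy, Matrix.mulVec_sub, Matrix.mulVec_smul, hw, Matrix.mulVec_mulVec, bbrim_mul_transpose]
    simp
  have hrow : ∀ r, bbrim ψ r j * y j + bbrim ψ r (j.succAbove i) * y (j.succAbove i) = 0 := by
    intro r
    have h := congrFun hθy r
    rw [Matrix.mulVec, dotProduct, Fin.sum_univ_succAbove _ j, Fin.sum_univ_succAbove _ i] at h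
    simpa [hy_other] using h
  have hyj : y j = 0 := by
    simpa [bbrim_self, ← hΔ, h0] using hrow (j.succAbove i)
  have hyi : y (j.succAbove i) = 0 := by
    simpa [bbrim_self, bbrim_swap ψ (j.succAbove i) j, ← hΔ, h0] using hrow j
  have hy0 : y = 0 := by
    funext r
    rcases Fin.eq_self_or_eq_succAbove j r with rfl | ⟨r, rfl⟩
    · exact hyj
    rcases Fin.eq_self_or_eq_succAbove i r with rfl | ⟨r, rfl⟩
    · exact hyi
    · exact hy_other r
  exact (sub_eq_zero.mp hy0).symm

lemma bbrim_smul_mem_range_bbrim [IsDomain A] {w : Fin (m + 2) → A}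
    (hw : ψ *ᵥ w = 0) (j : Fin (m + 2)) (i : Fin (m + 1)) :
    ∃ u, bbrim ψ *ᵥ u = bbrim ψ (j.succAbove i) j • w := by
  set p := j.succAbove i
  set Δ := bbrim ψ p j with hΔ
  by_cases h0 : Δ = 0
  · exact ⟨0, by rw [h0, zero_smul, Matrix.mulVec_zero]⟩
  set u : Fin (m + 2) → A := Pi.single j (w p) - Pi.single p (w j)
  refine ⟨u, ?_⟩
  have hθu : ∀ r, (bbrim ψ *ᵥ u) r = bbrim ψ r j * w p - bbrim ψ r p * w j := by
    intro r
    simp [u, Matrix.mulVec_sub, mul_comm]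
  set y := Δ • w - bbrim ψ *ᵥ u with hy
  have hyj : y j = 0 := by
    rw [hy, Pi.sub_apply, hθu, bbrim_self, bbrim_swap ψ p j, Pi.smul_apply, smul_eq_mul]
    ring
  have hyp : y p = 0 := by
    rw [hy, Pi.sub_apply, hθu, bbrim_self, Pi.smul_apply, smul_eq_mul]
    ring
  have hψy : ψ *ᵥ y = 0 := by
    rw [hy, Matrix.mulVec_sub, Matrix.mulVec_smul, hw, Matrix.mulVec_mulVec, mul_bbrim]
    simp
  have hM : (ψ.submatrix id fun q ↦ j.succAbove (i.succAbove q)).det ≠ 0 := by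
    intro h
    rw [hΔ, bbrim_succAbove, h, mul_zero] at h0
    exact h0 rfl
  have hy_other : (fun q ↦ y (j.succAbove (i.succAbove q))) = 0 := by
    refine Matrix.eq_zero_of_mulVec_eq_zero hM ?_
    rw [← hψy]
    funext r
    rw [Matrix.mulVec, Matrix.mulVec, dotProduct, dotProduct, Fin.sum_univ_succAbove _ j,
      Fin.sum_univ_succAbove _ i, hyj, hyp]
    simp
  have hy0 : y = 0 := by
    funext r
    rcases Fin.eq_self_or_eq_succAbove j r with rfl | ⟨r, rfl⟩
    · exact hyj
    rcases Fin.eq_self_or_eq_succAbove i r with rfl | ⟨r, rfl⟩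
    · exact hyp
    · exact congrFun hy_other r
  exact (sub_eq_zero.mp hy0).symm

lemma transpose_mulVec_injective [IsDomain A] (h : minorsIdeal m ψ ≠ ⊥) :
    Function.Injective ψᵀ.mulVecLin := by
  obtain ⟨j, i, h0⟩ : ∃ j i, bbrim ψ (Fin.succAbove j i) j ≠ 0 := by
    by_contra! h0
    exact h (le_bot_iff.mp (minorsIdeal_le ψ fun j i ↦ h0 j i))
  rw [bbrim_succAbove, ← Matrix.det_transpose] at h0
  rw [← LinearMap.ker_eq_bot, LinearMap.ker_eq_bot']
  intro v hv
  refine Matrix.eq_zero_of_mulVec_eq_zero (right_ne_zero_of_mul h0) ?_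
  funext q
  exact congrFun hv (j.succAbove (i.succAbove q))

end BuchsbaumRim

section Acyclicity

variable {R X Y Z W : Type*} [CommRing R] [AddCommGroup X] [AddCommGroup Y] [AddCommGroup Z]
  [AddCommGroup W] [Module R X] [Module R Y] [Module R Z] [Module R W]

lemma exists_of_isWeaklyRegular_three {a b c : R}
    (h : RingTheory.Sequence.IsWeaklyRegular R [a, b, c]) :
    (∀ x y : R, b * y = a * x → ∃ z, y = a * z) ∧
      ∀ x y z : R, c * z = a * x + b * y → ∃ u v, z = a * u + b * v := by
  constructor
  · intro x y hxy
    have := isSMulRegular_quotient_iff_mem_of_smul_mem _ _ |>.mp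
      (h.regular_mod_prev 1 (by simp)) y
    simp only [List.take_succ_cons, List.take_zero, Ideal.ofList_singleton, smul_eq_mul,
      Ideal.mul_top, Ideal.mem_span_singleton, List.getElem_cons_succ, List.getElem_cons_zero] at this
    exact this ⟨x, hxy⟩
  · intro x y z hxyz
    have := isSMulRegular_quotient_iff_mem_of_smul_mem _ _ |>.mp
      (h.regular_mod_prev 2 (by simp)) z
    simp only [List.take_succ_cons, List.take_zero, Ideal.ofList_cons, Ideal.ofList_nil,
      smul_eq_mul, Ideal.mul_top, List.getElem_cons_succ, List.getElem_cons_zero, sup_bot_eq,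
      ← Ideal.span_union, Set.singleton_union, Ideal.mem_span_pair] at this
    obtain ⟨u, v, huv⟩ := this ⟨x, y, by rw [hxyz]; ring⟩
    exact ⟨u, v, by rw [← huv]; ring⟩

/-- A complex `0 → X → Y → Z → W` that is exact at `X` is exact at `Y` if its homology there is
killed by a sequence `a, b` that is regular on `X`, and `a` is regular on `Y`. -/
lemma range_eq_ker_of_regular_pair {f : X →ₗ[R] Y} {g : Y →ₗ[R] Z} {a b : R}
    (hf : Function.Injective f) (hgf : g ∘ₗ f = 0)
    (hX : ∀ x y : X, b • y = a • x → ∃ z, y = a • z) (hY : IsSMulRegular Y a)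
    (ha : ∀ w, g w = 0 → a • w ∈ LinearMap.range f)
    (hb : ∀ w, g w = 0 → b • w ∈ LinearMap.range f) :
    LinearMap.range f = LinearMap.ker g := by
  refine le_antisymm (LinearMap.range_le_ker_iff.mpr hgf) fun w hw ↦ ?_
  obtain ⟨v, hv⟩ := ha w hw
  obtain ⟨u, hu⟩ := hb w hw
  obtain ⟨z, rfl⟩ := hX u v (hf (by rw [map_smul, map_smul, hv, hu, smul_comm]))
  exact ⟨z, hY (by simpa using hv)⟩

/-- A complex `0 → X → Y → Z → W` that is exact at `X` and `Y` is exact at `Z` if its homology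
there is killed by a sequence `a, b, c` that is regular on `X`, and `a, b` and `a` are
regular on `Y` and `Z`, respectively. -/
lemma range_eq_ker_of_regular_triple {f : X →ₗ[R] Y} {g : Y →ₗ[R] Z} {h : Z →ₗ[R] W} {a b c : R}
    (hf : Function.Injective f) (hfg : LinearMap.range f = LinearMap.ker g) (hhg : h ∘ₗ g = 0)
    (hX : ∀ x y z : X, c • z = a • x + b • y → ∃ u v, z = a • u + b • v)
    (hY : ∀ x y : Y, b • y = a • x → ∃ z, y = a • z)
    (hZ : IsSMulRegular Z a)
    (ha : ∀ w, h w = 0 → a • w ∈ LinearMap.range g)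
    (hb : ∀ w, h w = 0 → b • w ∈ LinearMap.range g)
    (hc : ∀ w, h w = 0 → c • w ∈ LinearMap.range g) :
    LinearMap.range g = LinearMap.ker h := by
  refine le_antisymm (LinearMap.range_le_ker_iff.mpr hhg) fun w hw ↦ ?_
  obtain ⟨u, hu⟩ := ha w hw
  obtain ⟨v, hv⟩ := hb w hw
  obtain ⟨z, hz⟩ := hc w hw
  have hker : ∀ {r s : R} {p q : Y}, g p = r • w → g q = s • w →
      ∃ x, f x = s • p - r • q := fun {r s p q} hp hq ↦ by
    have : s • p - r • q ∈ LinearMap.ker g := by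
      rw [LinearMap.mem_ker, map_sub, map_smul, map_smul, hp, hq, smul_comm, sub_self]
    rwa [← hfg] at this
  obtain ⟨x, hx⟩ := hker hu hv
  obtain ⟨y, hy⟩ := hker hu hz
  obtain ⟨t, ht⟩ := hker hv hz
  have hrel : c • x = a • (-t) + b • y := hf (by
    simp only [map_add, map_smul, map_neg, hx, hy, ht]
    module)
  obtain ⟨x₁, x₂, rfl⟩ := hX _ _ _ hrel
  rw [map_add, map_smul, map_smul] at hx
  obtain ⟨u', hu'⟩ := hY (v + f x₁) (u - f x₂) (by
    rw [smul_sub, smul_add, sub_eq_iff_eq_add, add_assoc, hx]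
    abel)
  have hgf : ∀ x, g (f x) = 0 := fun x ↦
    LinearMap.mem_ker.mp (hfg ▸ LinearMap.mem_range_self f x)
  refine ⟨u', hZ ?_⟩
  change a • g u' = a • w
  rw [← map_smul, ← hu', map_sub, hgf, sub_zero, hu]

end Acyclicity

lemma idealHeight_le_height {A : Type*} [CommRing A] (I : Ideal A) :
    idealHeight I ≤ I.height := by
  rw [Ideal.height_eq_inf_minimalPrimes]
  refine le_iInf₂ fun P hP ↦ ?_
  have := hP.isPrime
  exact (iInf₂_le ⟨P, hP.isPrime⟩ hP.1.2).trans_eq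
    (PrimeSpectrum.height_eq_orderHeight ⟨P, hP.isPrime⟩).symm

/-- Let `ψ : R(−δ)^s → R^{s−2}` be a graded map, given by an `(s−2)×s`
matrix of forms of degree `δ` over `R = k[x_1,…,x_d]`, with `ht I_{s−2}(ψ) = 3`, and let
`θ` be the `s×s` skew-symmetric matrix of signed `(s−2)`-minors of `ψ`.  Then
`0 → R^{s−2} →ψᵗ R^s →θ R^s →ψ R^{s−2} → coker ψ → 0` is exact (the Buchsbaum–Rim
resolution of `coker ψ`), and for a vector of indeterminates `T` one has `T·θ = (Δ_1,…,Δ_s)`,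
the signed maximal minors of `[Tᵗ | ψᵗ]`.  (Here `s = m + 2`.) -/
theorem statement6 {k : Type*} [Field k] {d m : ℕ} (hd : 1 ≤ d) (δ : ℕ)
    (ψ : Matrix (Fin m) (Fin (m + 2)) (MvPolynomial (Fin d) k))
    (hdeg : ∀ i j, (ψ i j).IsHomogeneous δ)
    (hht : idealHeight (minorsIdeal m ψ) = 3)
    (A : Matrix (Fin (m + 2)) (Fin (m + 1)) (MvPolynomial (Fin (m + 2)) (MvPolynomial (Fin d) k)))
    (hA : A = Matrix.of fun i c => Fin.cases (MvPolynomial.X i)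
      (fun c' => MvPolynomial.C (ψ c' i)) c) :
    (bbrim ψ)ᵀ = -(bbrim ψ) ∧
    Function.Injective (ψᵀ.mulVecLin) ∧
    LinearMap.range (ψᵀ.mulVecLin) = LinearMap.ker ((bbrim ψ).mulVecLin) ∧
    LinearMap.range ((bbrim ψ).mulVecLin) = LinearMap.ker (ψ.mulVecLin) ∧
    ∀ j : Fin (m + 2),
      (∑ i : Fin (m + 2), MvPolynomial.X i * MvPolynomial.C ((bbrim ψ) i j)) =
        (-1) ^ (j : ℕ) * (A.submatrix (Fin.succAbove j) id).det := by
  obtain rfl : A = _ := hA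
  have h3 : ((3 : ℕ) : ℕ∞) ≤ (minorsIdeal m ψ).height :=
    (by simpa using hht.ge : ((3 : ℕ) : ℕ∞) ≤ _).trans (idealHeight_le_height _)
  have hbot : minorsIdeal m ψ ≠ ⊥ := by
    intro h
    simp [h] at h3
  obtain ⟨rs, hrs, hlen, hreg⟩ := exists_isWeaklyRegular_of_le_height 3 _ h3
  obtain ⟨a, b, c, rfl⟩ := List.length_eq_three.mp hlen
  have hminor₁ : ∀ x ∈ minorsIdeal m ψ, ∀ w, (bbrim ψ).mulVecLin w = 0 →
      x • w ∈ LinearMap.range ψᵀ.mulVecLin := fun x hx w hw ↦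
    minorsIdeal_le ψ (K := (LinearMap.range ψᵀ.mulVecLin).comap (LinearMap.toSpanSingleton _ _ w))
      (bbrim_smul_mem_range_transpose hw) hx
  have hminor₂ : ∀ x ∈ minorsIdeal m ψ, ∀ w, ψ.mulVecLin w = 0 →
      x • w ∈ LinearMap.range (bbrim ψ).mulVecLin := fun x hx w hw ↦
    minorsIdeal_le ψ
      (K := (LinearMap.range (bbrim ψ).mulVecLin).comap (LinearMap.toSpanSingleton _ _ w))
      (bbrim_smul_mem_range_bbrim hw) hx
  have hinj := transpose_mulVec_injective hbot
  obtain ⟨h₂, h₃⟩ := exists_of_isWeaklyRegular_three hreg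
  have hpi₂ : ∀ {n : ℕ} (x y : Fin n → MvPolynomial (Fin d) k), b • y = a • x →
      ∃ z : Fin n → MvPolynomial (Fin d) k, y = a • z := fun x y h ↦ by
    choose z hz using fun i ↦ h₂ _ _ (congrFun h i)
    exact ⟨z, funext hz⟩
  have hpi₃ : ∀ {n : ℕ} (x y z : Fin n → MvPolynomial (Fin d) k), c • z = a • x + b • y →
      ∃ u v : Fin n → MvPolynomial (Fin d) k, z = a • u + b • v := fun x y z h ↦ by
    choose u v huv using fun i ↦ h₃ _ _ _ (congrFun h i)
    exact ⟨u, v, funext huv⟩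
  have hreg_a : IsSMulRegular (Fin (m + 2) → MvPolynomial (Fin d) k) a :=
    IsSMulRegular.pi fun _ ↦ ((RingTheory.Sequence.isWeaklyRegular_cons_iff _ _ _).mp hreg).1
  have hexact : LinearMap.range ψᵀ.mulVecLin = LinearMap.ker (bbrim ψ).mulVecLin :=
    range_eq_ker_of_regular_pair hinj
      (by rw [← Matrix.mulVecLin_mul, bbrim_mul_transpose, Matrix.mulVecLin_zero]) hpi₂ hreg_a
      (hminor₁ a (hrs a (by simp))) (hminor₁ b (hrs b (by simp)))
  refine ⟨bbrim_transpose ψ, hinj, hexact,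
    range_eq_ker_of_regular_triple hinj hexact
      (by rw [← Matrix.mulVecLin_mul, mul_bbrim, Matrix.mulVecLin_zero]) hpi₃ hpi₂ hreg_a
      (hminor₂ a (hrs a (by simp))) (hminor₂ b (hrs b (by simp))) (hminor₂ c (hrs c (by simp))),
    fun j ↦ ?_⟩
  have h := sum_mul_bbrim (ψ.map (C (σ := Fin (m + 2)))) X j
  rw [bbrim_map] at h
  exact h
end

section
/- Let R = k[x_1,…,x_d] be a standard graded polynomial ring over a field and let ψ : R(−1)^{n−1} → R^{n−d} be a graded map given by an (n−d)×(n−1) matrix of linear forms (n−1 ≥ n−d). Then the ideal of maximal minors I_{n−d}(ψ) equals (x_1,…,x_d)^{n−d} if and only if ht I_{n−d}(ψ) = d. -/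
open Matrix MvPolynomial

noncomputable section

namespace InverseKoszul

open scoped Pointwise

variable {A : Type*} [CommRing A] {p q : ℕ} {N : Type*} [AddCommGroup N] [Module A N]

/-- Elements of `⋀ Aᵠ ⊗ N[y₁⁻¹, …, y_p⁻¹]`, written by coordinates: the value at `a` and `S` is
the coefficient of `e_S ⊗ ∏ yᵢ ^ (-aᵢ - 1)`. -/
abbrev Chain (p q : ℕ) (N : Type*) : Type _ := (Fin p → ℕ) → Finset (Fin q) → N

/-- The sign produced by moving `e_j` past the factors of `e_S` with smaller index. -/
def colSign (j : Fin q) (S : Finset (Fin q)) : ℤ := (-1) ^ (S.filter (· < j)).card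

lemma colSign_mul_self (j : Fin q) (S : Finset (Fin q)) : colSign j S * colSign j S = 1 := by
  rw [colSign, ← mul_pow]
  simp

lemma colSign_insert {j l : Fin q} {S : Finset (Fin q)} (hl : l ∉ S) :
    colSign j (insert l S) = if l < j then -colSign j S else colSign j S := by
  unfold colSign
  rw [Finset.filter_insert]
  split_ifs with h
  · rw [Finset.card_insert_of_notMem (by simp [hl]), pow_succ]
    simp
  · rfl

lemma end_neg_mul {M : Type*} [AddCommGroup M] [Module A M] (f g : Module.End A M) :
    -f * g = -(f * g) := rfl

variable (A p N) in
/-- Contraction by the `j`-th coordinate form. -/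
def remove (j : Fin q) : Module.End A (Chain p q N) where
  toFun η a S := if j ∈ S then 0 else colSign j S • η a (insert j S)
  map_add' η θ := by ext a S; simp only [Pi.add_apply]; split_ifs <;> simp
  map_smul' c η := by
    ext a S; simp only [Pi.smul_apply, RingHom.id_apply]; split_ifs <;> simp [smul_comm c]

variable (A p N) in
/-- Left exterior multiplication by the `j`-th basis vector. -/
def adjoin (j : Fin q) : Module.End A (Chain p q N) where
  toFun η a S := if j ∈ S then colSign j (S.erase j) • η a (S.erase j) else 0
  map_add' η θ := by ext a S; simp only [Pi.add_apply]; split_ifs <;> simp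
  map_smul' c η := by
    ext a S; simp only [Pi.smul_apply, RingHom.id_apply]; split_ifs <;> simp [smul_comm c]

variable (A q N) in
/-- Multiplication by `yᵢ` on inverse polynomials. -/
def lower (i : Fin p) : Module.End A (Chain p q N) where
  toFun η a S := η (a + Pi.single i 1) S
  map_add' _ _ := rfl
  map_smul' _ _ := rfl

variable (A q N) in
/-- Multiplication by `yᵢ⁻¹` on inverse polynomials. -/
def raise (i : Fin p) : Module.End A (Chain p q N) where
  toFun η a S := if a i = 0 then 0 else η (a - Pi.single i 1) S
  map_add' η θ := by ext a S; simp only [Pi.add_apply]; split_ifs <;> simp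
  map_smul' c η := by
    ext a S; simp only [Pi.smul_apply, RingHom.id_apply]; split_ifs <;> simp

variable (A q N) in
/-- Projection to the inverse monomials having exponent `-1` at `yᵢ`. -/
def proj (i : Fin p) : Module.End A (Chain p q N) where
  toFun η a S := if a i = 0 then η a S else 0
  map_add' η θ := by ext a S; simp only [Pi.add_apply]; split_ifs <;> simp
  map_smul' c η := by
    ext a S; simp only [Pi.smul_apply, RingHom.id_apply]; split_ifs <;> simp

lemma remove_apply (j : Fin q) (η : Chain p q N) (a S) :
    remove A p N j η a S = if j ∈ S then 0 else colSign j S • η a (insert j S) := rfl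

lemma adjoin_apply (j : Fin q) (η : Chain p q N) (a S) :
    adjoin A p N j η a S = if j ∈ S then colSign j (S.erase j) • η a (S.erase j) else 0 := rfl

lemma lower_apply (i : Fin p) (η : Chain p q N) (a S) :
    lower A q N i η a S = η (a + Pi.single i 1) S := rfl

lemma raise_apply (i : Fin p) (η : Chain p q N) (a S) :
    raise A q N i η a S = if a i = 0 then 0 else η (a - Pi.single i 1) S := rfl

lemma proj_apply (i : Fin p) (η : Chain p q N) (a S) :
    proj A q N i η a S = if a i = 0 then η a S else 0 := rfl

lemma remove_mul_self (j : Fin q) : remove A p N j * remove A p N j = 0 := by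
  ext η a S
  simp [remove_apply]

lemma remove_anticomm (j l : Fin q) :
    remove A p N j * remove A p N l = -(remove A p N l * remove A p N j) := by
  rcases eq_or_ne j l with rfl | hjl
  · simp [remove_mul_self]
  ext η a S
  simp only [Module.End.mul_apply, LinearMap.neg_apply, Pi.neg_apply, remove_apply,
    Finset.mem_insert, hjl, hjl.symm, false_or]
  by_cases hj : j ∈ S <;> by_cases hl : l ∈ S <;> simp only [hj, hl, if_true, if_false, smul_zero,
    neg_zero]
  rw [colSign_insert hj, colSign_insert hl, Finset.insert_comm, smul_smul, smul_smul, ← neg_smul]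
  congr 1
  rcases lt_or_gt_of_ne hjl with h | h <;> simp [h, h.not_gt, mul_comm]

lemma adjoin_remove (j l : Fin q) :
    adjoin A p N j * remove A p N l + remove A p N l * adjoin A p N j =
      if j = l then 1 else 0 := by
  split_ifs with hjl
  · subst hjl
    ext η a S
    simp only [Module.End.mul_apply, LinearMap.add_apply, Pi.add_apply, remove_apply,
      adjoin_apply, Module.End.one_apply]
    by_cases hj : j ∈ S
    · simp [hj, smul_smul, colSign_mul_self]
    · simp [hj, smul_smul, colSign_mul_self]
  · ext η a S
    have hlj : l ≠ j := Ne.symm hjl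
    simp only [Module.End.mul_apply, LinearMap.add_apply, Pi.add_apply, remove_apply,
      adjoin_apply, LinearMap.zero_apply, Pi.zero_apply, Finset.mem_insert, Finset.mem_erase,
      hjl, hlj, false_or, ne_eq, not_false_eq_true, true_and]
    by_cases hj : j ∈ S <;> by_cases hl : l ∈ S <;> simp only [hj, hl, if_true, if_false,
      smul_zero, add_zero]
    obtain ⟨T, hjT, rfl⟩ : ∃ T, j ∉ T ∧ S = insert j T :=
      ⟨S.erase j, by simp, by simp [Finset.insert_erase hj]⟩
    have hlT : l ∉ T := fun h => hl (Finset.mem_insert_of_mem h)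
    rw [Finset.insert_comm l j T, Finset.erase_insert hjT,
      Finset.erase_insert (by simp [hjl, hjT]), colSign_insert hjT, colSign_insert hlT,
      smul_smul, smul_smul, ← add_smul]
    convert zero_smul ℤ _
    rcases lt_or_gt_of_ne hjl with h | h <;> simp [h, h.not_gt, mul_comm]

lemma lower_comm (i l : Fin p) : lower A q N i * lower A q N l = lower A q N l * lower A q N i := by
  ext η a S
  simp only [Module.End.mul_apply, lower_apply, add_right_comm]

lemma lower_raise_self (i : Fin p) : lower A q N i * raise A q N i = 1 := by
  ext η a S
  simp [lower_apply, raise_apply]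

lemma lower_raise_of_ne {i l : Fin p} (h : l ≠ i) :
    lower A q N l * raise A q N i = raise A q N i * lower A q N l := by
  ext η a S
  simp only [Module.End.mul_apply, lower_apply, raise_apply, Pi.add_apply,
    Pi.single_eq_of_ne' h, add_zero]
  split_ifs with h0
  · rfl
  · congr 1
    ext m
    simp only [Pi.add_apply, Pi.sub_apply]
    rcases eq_or_ne m i with rfl | hm
    · simp [Pi.single_eq_of_ne' h]
    · simp [Pi.single_eq_of_ne hm]

lemma raise_lower_self (i : Fin p) : raise A q N i * lower A q N i = 1 - proj A q N i := by
  ext η a S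
  simp only [Module.End.mul_apply, lower_apply, raise_apply, LinearMap.sub_apply, Pi.sub_apply,
    Module.End.one_apply, proj_apply]
  split_ifs with h0
  · simp
  · rw [sub_zero]
    congr 1
    ext m
    rcases eq_or_ne m i with rfl | hm
    · simp; omega
    · simp [Pi.single_eq_of_ne hm]

lemma remove_lower (j : Fin q) (i : Fin p) :
    lower A q N i * remove A p N j = remove A p N j * lower A q N i := rfl

lemma adjoin_lower (j : Fin q) (i : Fin p) :
    lower A q N i * adjoin A p N j = adjoin A p N j * lower A q N i := rfl

lemma remove_raise (j : Fin q) (i : Fin p) :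
    raise A q N i * remove A p N j = remove A p N j * raise A q N i := by
  ext η a S
  simp only [Module.End.mul_apply, raise_apply, remove_apply]
  split_ifs <;> simp

/-- Contraction by the `i`-th row of `ψ`. -/
def rowContract (N : Type*) [AddCommGroup N] [Module A N] (ψ : Matrix (Fin p) (Fin q) A)
    (i : Fin p) : Module.End A (Chain p q N) :=
  ∑ j, ψ i j • remove A p N j

/-- Left exterior multiplication by the `i`-th column of `G`. -/
def colWedge (N : Type*) [AddCommGroup N] [Module A N] (G : Matrix (Fin q) (Fin p) A)
    (i : Fin p) : Module.End A (Chain p q N) :=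
  ∑ j, G j i • adjoin A p N j

/-- The Koszul differential of the bilinear forms `∑ᵢ ψᵢⱼ yᵢ`. -/
def differential (N : Type*) [AddCommGroup N] [Module A N] (ψ : Matrix (Fin p) (Fin q) A) :
    Module.End A (Chain p q N) :=
  ∑ i, rowContract N ψ i * lower A q N i

lemma rowContract_anticomm (ψ : Matrix (Fin p) (Fin q) A) (i l : Fin p) :
    rowContract N ψ i * rowContract N ψ l = -(rowContract N ψ l * rowContract N ψ i) := by
  simp only [rowContract, Finset.sum_mul_sum, smul_mul_smul_comm]
  rw [Finset.sum_comm, ← Finset.sum_neg_distrib]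
  refine Finset.sum_congr rfl fun j _ => ?_
  rw [← Finset.sum_neg_distrib]
  refine Finset.sum_congr rfl fun m _ => ?_
  rw [remove_anticomm, smul_neg, mul_comm]

lemma colWedge_rowContract (ψ : Matrix (Fin p) (Fin q) A) (G : Matrix (Fin q) (Fin p) A)
    (i l : Fin p) :
    colWedge N G i * rowContract N ψ l + rowContract N ψ l * colWedge N G i = (ψ * G) l i • 1 := by
  simp only [colWedge, rowContract, Finset.sum_mul_sum, smul_mul_smul_comm]
  rw [Finset.sum_comm (f := fun j m => (ψ l j * G m i) • _), ← Finset.sum_add_distrib,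
    Matrix.mul_apply, Finset.sum_smul]
  refine Finset.sum_congr rfl fun j _ => ?_
  rw [← Finset.sum_add_distrib]
  simp only [mul_comm (ψ l _) (G j i), ← smul_add, adjoin_remove]
  simp

lemma lower_rowContract (ψ : Matrix (Fin p) (Fin q) A) (i l : Fin p) :
    lower A q N i * rowContract N ψ l = rowContract N ψ l * lower A q N i := by
  simp only [rowContract, Finset.mul_sum, Finset.sum_mul, mul_smul_comm, smul_mul_assoc,
    remove_lower]

lemma lower_colWedge (G : Matrix (Fin q) (Fin p) A) (i l : Fin p) :
    lower A q N i * colWedge N G l = colWedge N G l * lower A q N i := by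
  simp only [colWedge, Finset.mul_sum, Finset.sum_mul, mul_smul_comm, smul_mul_assoc,
    adjoin_lower]

lemma raise_rowContract (ψ : Matrix (Fin p) (Fin q) A) (i l : Fin p) :
    raise A q N i * rowContract N ψ l = rowContract N ψ l * raise A q N i := by
  simp only [rowContract, Finset.mul_sum, Finset.sum_mul, mul_smul_comm, smul_mul_assoc,
    remove_raise]

variable (ψ : Matrix (Fin p) (Fin q) A)

variable (N) in
/-- Contraction by a linear form, as a linear function of the form. -/
def contraction : (Fin q → A) →ₗ[A] Module.End A (Chain p q N) :=
  Fintype.linearCombination A (remove A p N)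

lemma contraction_mul_self (v : Fin q → A) :
    contraction (p := p) N v * contraction N v = 0 := by
  simp only [contraction, Fintype.linearCombination_apply, Finset.sum_mul_sum, smul_mul_smul_comm]
  rw [← Finset.sum_product']
  refine Finset.sum_involution (fun x _ => (x.2, x.1)) ?_ ?_ (by simp) (by simp)
  · rintro ⟨j, l⟩ -
    rw [remove_anticomm, mul_comm]
    simp
  · rintro ⟨j, l⟩ - h hjl
    obtain rfl : l = j := congrArg Prod.fst hjl
    simp [remove_mul_self] at h

lemma rowContract_eq_contraction (i : Fin p) : rowContract N ψ i = contraction N (ψ i) := rfl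

lemma rowContract_mul_self (i : Fin p) : rowContract N ψ i * rowContract N ψ i = 0 :=
  contraction_mul_self (ψ i)

lemma differential_mul_self : differential N ψ * differential N ψ = 0 := by
  simp only [differential, Finset.sum_mul_sum]
  rw [← Finset.sum_product']
  refine Finset.sum_involution (fun x _ => (x.2, x.1)) ?_ ?_ (by simp) (by simp)
  · rintro ⟨i, l⟩ -
    simp only
    rw [mul_assoc, ← mul_assoc (lower A q N i), lower_rowContract, mul_assoc, ← mul_assoc,
      rowContract_anticomm, mul_assoc (rowContract N ψ l), ← mul_assoc (lower A q N l),
      lower_rowContract, lower_comm]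
    rw [end_neg_mul]
    simp only [mul_assoc]
    rw [neg_add_cancel]
  · rintro ⟨i, l⟩ - h hil
    obtain rfl : l = i := congrArg Prod.fst hil
    refine absurd ?_ h
    simp only
    rw [mul_assoc, ← mul_assoc (lower A q N l), lower_rowContract, mul_assoc, ← mul_assoc,
      rowContract_mul_self, zero_mul]

lemma differential_homotopy {G : Matrix (Fin q) (Fin p) A} {Δ : A}
    (hG : ψ * G = Δ • (1 : Matrix (Fin p) (Fin p) A)) (i : Fin p) :
    differential N ψ * (colWedge N G i * raise A q N i) +
      colWedge N G i * raise A q N i * differential N ψ =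
      Δ • 1 - colWedge N G i * rowContract N ψ i * proj A q N i := by
  have key (l : Fin p) :
      rowContract N ψ l * lower A q N l * (colWedge N G i * raise A q N i) +
        colWedge N G i * raise A q N i * (rowContract N ψ l * lower A q N l) =
      if l = i then Δ • 1 - colWedge N G i * rowContract N ψ i * proj A q N i else 0 := by
    have h1 : rowContract N ψ l * lower A q N l * (colWedge N G i * raise A q N i) =
        rowContract N ψ l * colWedge N G i * (lower A q N l * raise A q N i) := by
      rw [mul_assoc, ← mul_assoc (lower A q N l), lower_colWedge]
      simp only [mul_assoc]
    have h2 : colWedge N G i * raise A q N i * (rowContract N ψ l * lower A q N l) =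
        colWedge N G i * rowContract N ψ l * (raise A q N i * lower A q N l) := by
      rw [mul_assoc, ← mul_assoc (raise A q N i), raise_rowContract]
      simp only [mul_assoc]
    have h3 := colWedge_rowContract (N := N) ψ G i l
    rw [h1, h2]
    split_ifs with hl
    · subst hl
      rw [hG, Matrix.smul_apply, Matrix.one_apply_eq, smul_eq_mul, mul_one] at h3
      rw [lower_raise_self, raise_lower_self, mul_sub, mul_one, mul_one, ← h3]
      abel
    · rw [hG, Matrix.smul_apply, Matrix.one_apply_ne hl, smul_zero, zero_smul] at h3
      rw [lower_raise_of_ne hl, ← add_mul, add_comm, h3, zero_mul]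
  simp only [differential, Finset.sum_mul, Finset.mul_sum]
  rw [← Finset.sum_add_distrib, Finset.sum_congr rfl fun l _ => key l]
  simp

variable (A p q N) in
/-- Chains of exterior degree `s` whose inverse monomials are `yᵢ ^ (-aᵢ - 1)` with `∑ aᵢ = t`. -/
def piece (t s : ℕ) : Submodule A (Chain p q N) where
  carrier := {η | ∀ a S, η a S ≠ 0 → ∑ i, a i = t ∧ S.card = s}
  zero_mem' := fun a S h => absurd rfl h
  add_mem' := fun {η θ} hη hθ a S h => by
    by_cases h1 : η a S = 0
    · exact hθ a S fun h2 => h (by simp [h1, h2])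
    · exact hη a S h1
  smul_mem' := fun c η hη a S h => hη a S fun h1 => h (by simp [h1])

lemma sum_add_single (a : Fin p → ℕ) (i : Fin p) :
    ∑ m, (a + Pi.single i 1 : Fin p → ℕ) m = ∑ m, a m + 1 := by
  simp [Finset.sum_add_distrib]

variable {t s : ℕ} {η : Chain p q N}

lemma remove_mem (hη : η ∈ piece A p q N t (s + 1)) (j : Fin q) :
    remove A p N j η ∈ piece A p q N t s := by
  intro a S h
  rw [remove_apply] at h
  split_ifs at h with hj
  · exact absurd rfl h
  · have := hη _ _ (right_ne_zero_of_smul h)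
    rw [Finset.card_insert_of_notMem hj] at this
    omega

lemma adjoin_mem (hη : η ∈ piece A p q N t s) (j : Fin q) :
    adjoin A p N j η ∈ piece A p q N t (s + 1) := by
  intro a S h
  rw [adjoin_apply] at h
  split_ifs at h with hj
  · have := hη _ _ (right_ne_zero_of_smul h)
    rw [Finset.card_erase_of_mem hj] at this
    have := Finset.card_pos.mpr ⟨j, hj⟩
    omega
  · exact absurd rfl h

lemma lower_mem (hη : η ∈ piece A p q N (t + 1) s) (i : Fin p) :
    lower A q N i η ∈ piece A p q N t s := by
  intro a S h
  have := hη _ _ h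
  rw [sum_add_single] at this
  omega

lemma raise_mem (hη : η ∈ piece A p q N t s) (i : Fin p) :
    raise A q N i η ∈ piece A p q N (t + 1) s := by
  intro a S h
  rw [raise_apply] at h
  split_ifs at h with h0
  · exact absurd rfl h
  · have h1 := hη _ _ h
    have h2 := sum_add_single (a - Pi.single i 1) i
    rw [show a - Pi.single i 1 + Pi.single i 1 = a from ?_] at h2
    · omega
    · ext m
      rcases eq_or_ne m i with rfl | hm
      · simp; omega
      · simp [Pi.single_eq_of_ne hm]

lemma proj_mem (hη : η ∈ piece A p q N t s) (i : Fin p) :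
    proj A q N i η ∈ piece A p q N t s := by
  intro a S h
  rw [proj_apply] at h
  split_ifs at h
  · exact hη _ _ h
  · exact absurd rfl h

lemma rowContract_mem (hη : η ∈ piece A p q N t (s + 1)) (i : Fin p) :
    rowContract N ψ i η ∈ piece A p q N t s := by
  rw [rowContract, LinearMap.sum_apply]
  exact Submodule.sum_mem _ fun j _ => Submodule.smul_mem _ _ (remove_mem hη j)

lemma colWedge_mem (G : Matrix (Fin q) (Fin p) A) (hη : η ∈ piece A p q N t s) (i : Fin p) :
    colWedge N G i η ∈ piece A p q N t (s + 1) := by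
  rw [colWedge, LinearMap.sum_apply]
  exact Submodule.sum_mem _ fun j _ => Submodule.smul_mem _ _ (adjoin_mem hη j)

lemma differential_mem (hη : η ∈ piece A p q N (t + 1) (s + 1)) :
    differential N ψ η ∈ piece A p q N t s := by
  rw [differential, LinearMap.sum_apply]
  exact Submodule.sum_mem _ fun i _ => rowContract_mem ψ (lower_mem hη i) i

lemma colWedge_apply_eq_zero (G : Matrix (Fin q) (Fin p) A) (i : Fin p) {a : Fin p → ℕ}
    (h : η a = 0) : colWedge N G i η a = 0 := by
  ext S
  simp [colWedge, LinearMap.sum_apply, Finset.sum_apply, adjoin_apply, h]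

lemma rowContract_apply_eq_zero (i : Fin p) {a : Fin p → ℕ}
    (h : η a = 0) : rowContract N ψ i η a = 0 := by
  ext S
  simp [rowContract, LinearMap.sum_apply, Finset.sum_apply, remove_apply, h]

lemma differential_apply_eq_zero_of_mem_piece_zero (hη : η ∈ piece A p q N 0 s) :
    differential N ψ η = 0 := by
  have (i : Fin p) : lower A q N i η = 0 := by
    ext a S
    by_contra h
    have := hη _ _ h
    rw [sum_add_single] at this
    omega
  simp [differential, LinearMap.sum_apply, this]

lemma proj_of_mem_piece_zero (hη : η ∈ piece A p q N 0 s) (i : Fin p) :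
    proj A q N i η = η := by
  ext a S
  rw [proj_apply]
  split_ifs with h
  · rfl
  · by_contra h0
    have := (hη a S (Ne.symm h0)).1
    rw [Finset.sum_eq_zero_iff] at this
    exact h (this i (Finset.mem_univ i))

variable (G : Matrix (Fin q) (Fin p) A)

/-- An operator which on cycles is homotopic to multiplication by `Δ` when `ψ * G = Δ • 1`. -/
def retract (N : Type*) [AddCommGroup N] [Module A N] (i : Fin p) :
    Module.End A (Chain p q N) :=
  colWedge N G i * rowContract N ψ i * proj A q N i

lemma retract_mem (hη : η ∈ piece A p q N t (s + 1)) (i : Fin p) :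
    retract ψ G N i η ∈ piece A p q N t (s + 1) :=
  colWedge_mem G (rowContract_mem ψ (proj_mem hη i) i) i

variable (N) in
/-- The boundaries among chains of exterior degree `p + t` and inverse degree `t`. -/
def boundaries (t : ℕ) : Submodule A (Chain p q N) :=
  (piece A p q N (t + 1) (p + t + 1)).map (differential N ψ)

lemma retract_prod {Δ : A} (hG : ψ * G = Δ • (1 : Matrix (Fin p) (Fin p) A))
    (hη : η ∈ piece A p q N t (p + t)) (hc : differential N ψ η = 0) (L : List (Fin p)) :
    (L.map (retract ψ G N)).prod η ∈ piece A p q N t (p + t) ∧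
      differential N ψ ((L.map (retract ψ G N)).prod η) = 0 ∧
      Δ ^ L.length • η - (L.map (retract ψ G N)).prod η ∈ boundaries N ψ t := by
  induction L with
  | nil => simp [hη, hc]
  | cons i L ih =>
    rw [List.map_cons, List.prod_cons, Module.End.mul_apply, List.length_cons]
    set θ := (L.map (retract ψ G N)).prod η
    obtain ⟨h1, h2, h3⟩ := ih
    have hpt : ∃ s, p + t = s + 1 := ⟨p + t - 1, by have := i.pos; omega⟩
    have h4 := LinearMap.congr_fun (differential_homotopy (N := N) ψ hG i) θ
    simp only [LinearMap.add_apply, Module.End.mul_apply, h2, map_zero, add_zero,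
      LinearMap.sub_apply, LinearMap.smul_apply, Module.End.one_apply] at h4
    have h5 : retract ψ G N i θ =
        Δ • θ - differential N ψ (colWedge N G i (raise A q N i θ)) := by
      rw [h4]; simp [retract]
    refine ⟨?_, ?_, ?_⟩
    · obtain ⟨s, hs⟩ := hpt
      rw [hs] at h1 ⊢
      exact retract_mem ψ G h1 i
    · rw [h5, map_sub, map_smul, h2, ← Module.End.mul_apply, differential_mul_self]
      simp
    · have h6 : differential N ψ (colWedge N G i (raise A q N i θ)) ∈ boundaries N ψ t :=
        Submodule.mem_map_of_mem (colWedge_mem G (raise_mem h1 i) i)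
      have h7 := Submodule.add_mem _ (Submodule.smul_mem _ Δ h3) h6
      convert h7 using 1
      rw [h5, pow_succ', mul_smul, smul_sub]
      abel

lemma retract_prod_apply_eq_zero (L : List (Fin p)) {a : Fin p → ℕ} (h : ∃ i ∈ L, a i ≠ 0) :
    (L.map (retract ψ G N)).prod η a = 0 := by
  induction L with
  | nil => simp at h
  | cons i L ih =>
    rw [List.map_cons, List.prod_cons, Module.End.mul_apply, retract]
    simp only [Module.End.mul_apply]
    refine colWedge_apply_eq_zero G i (rowContract_apply_eq_zero ψ i ?_)
    ext S
    rw [proj_apply]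
    split_ifs with h0
    · obtain ⟨l, hl, hal⟩ := h
      rcases List.mem_cons.mp hl with rfl | hl
      · exact absurd h0 hal
      · exact congrFun (ih ⟨l, hl, hal⟩) S
    · rfl

lemma pow_smul_mem_boundaries {Δ : A} (hG : ψ * G = Δ • (1 : Matrix (Fin p) (Fin p) A))
    (ht : 1 ≤ t) (hη : η ∈ piece A p q N t (p + t)) (hc : differential N ψ η = 0) :
    Δ ^ p • η ∈ boundaries N ψ t := by
  obtain ⟨h1, -, h3⟩ := retract_prod ψ G hG hη hc (List.finRange p)
  have h0 : ((List.finRange p).map (retract ψ G N)).prod η = 0 := by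
    ext a S
    by_contra h
    have hsum := (h1 a S h).1
    obtain ⟨i, -, hi⟩ := Finset.exists_ne_zero_of_sum_ne_zero (by omega : ∑ i, a i ≠ 0)
    exact h (congrFun (retract_prod_apply_eq_zero ψ G _ ⟨i, List.mem_finRange i, hi⟩) S)
  simpa [h0] using h3

/-- The scalars `Δ` for which `Δ • 1` factors through `ψ`; maximal minors are of this kind. -/
def splitScalars : Set A :=
  {Δ | ∃ G : Matrix (Fin q) (Fin p) A, ψ * G = Δ • (1 : Matrix (Fin p) (Fin p) A)}

lemma exists_pow_smul_mem {B : Submodule A (Chain p q N)} {n : ℕ} {r : A}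
    (hr : r ∈ (Ideal.span (splitScalars ψ)).radical)
    (h : ∀ Δ ∈ splitScalars ψ, Δ ^ n • η ∈ B) : ∃ m : ℕ, r ^ m • η ∈ B := by
  let J : Ideal A := B.comap (LinearMap.toSpanSingleton A _ η)
  have hJ : Ideal.span (splitScalars ψ) ≤ J.radical :=
    Ideal.span_le.mpr fun Δ hΔ => ⟨n, h Δ hΔ⟩
  exact (Ideal.radical_le_radical_iff.mpr hJ) hr

/-- Change of coefficients. -/
def mapCoeff {N' : Type*} [AddCommGroup N'] [Module A N'] (f : N →ₗ[A] N') :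
    Chain p q N →ₗ[A] Chain p q N' where
  toFun η a S := f (η a S)
  map_add' η θ := by ext; simp
  map_smul' c η := by ext; simp

lemma mapCoeff_differential {N' : Type*} [AddCommGroup N'] [Module A N'] (f : N →ₗ[A] N')
    (η : Chain p q N) : mapCoeff f (differential N ψ η) = differential N' ψ (mapCoeff f η) := by
  simp only [differential, LinearMap.sum_apply, map_sum]
  refine Finset.sum_congr rfl fun i _ => ?_
  simp only [Module.End.mul_apply, rowContract, LinearMap.sum_apply, map_sum]
  refine Finset.sum_congr rfl fun j _ => ?_
  rw [LinearMap.smul_apply, LinearMap.smul_apply, map_smul]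
  congr 1
  ext a S
  simp only [mapCoeff, LinearMap.coe_mk, AddHom.coe_mk, remove_apply, lower_apply]
  split_ifs <;> simp

lemma mapCoeff_mem {N' : Type*} [AddCommGroup N'] [Module A N'] (f : N →ₗ[A] N')
    (hη : η ∈ piece A p q N t s) : mapCoeff f η ∈ piece A p q N' t s :=
  fun a S h => hη a S fun h0 => h (by simp [mapCoeff, h0])

lemma exists_mapCoeff_eq {N' : Type*} [AddCommGroup N'] [Module A N'] {f : N →ₗ[A] N'}
    (hf : Function.Surjective f) {θ : Chain p q N'} (hθ : θ ∈ piece A p q N' t s) :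
    ∃ η ∈ piece A p q N t s, mapCoeff f η = θ := by
  classical
  choose g hg using hf
  refine ⟨fun a S => if θ a S = 0 then 0 else g (θ a S), fun a S h => ?_, ?_⟩
  · by_cases h0 : θ a S = 0
    · simp [h0] at h
    · exact hθ a S h0
  · ext a S
    simp only [mapCoeff, LinearMap.coe_mk, AddHom.coe_mk]
    split_ifs with h0
    · simp [h0]
    · exact hg _

/-- If the strand is exact in degree `t + 1` modulo a regular element `r`, then `r` is regular on
the cokernel in degree `t`. -/
lemma mem_boundaries_of_smul_mem {r : A} (hr : IsSMulRegular N r)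
    (hex : ∀ θ ∈ piece A p q (QuotSMulTop r N) (t + 1) (p + (t + 1)),
      differential (QuotSMulTop r N) ψ θ = 0 → θ ∈ boundaries (QuotSMulTop r N) ψ (t + 1))
    (h : r • η ∈ boundaries N ψ t) : η ∈ boundaries N ψ t := by
  classical
  let π : N →ₗ[A] QuotSMulTop r N := Submodule.mkQ _
  have hπ : Function.Surjective π := Submodule.mkQ_surjective _
  have hker (n : N) (hn : π n = 0) : ∃ m, r • m = n := by
    have : n ∈ r • (⊤ : Submodule A N) := (Submodule.Quotient.mk_eq_zero _).mp hn
    obtain ⟨m, -, hm⟩ := (Submodule.mem_smul_pointwise_iff_exists _ _ _).mp this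
    exact ⟨m, hm⟩
  have hkill (n : N) : π (r • n) = 0 := by
    exact (Submodule.Quotient.mk_eq_zero _).mpr
      (Submodule.smul_mem_pointwise_smul n r ⊤ trivial)
  obtain ⟨ζ, hζ, hζη⟩ := h
  obtain ⟨ξ', hξ', hξζ⟩ := hex (mapCoeff π ζ) (mapCoeff_mem π hζ) (by
    rw [← mapCoeff_differential, hζη]
    ext a S
    exact hkill _)
  obtain ⟨ξ, hξ, rfl⟩ := exists_mapCoeff_eq hπ hξ'
  rw [← mapCoeff_differential] at hξζ
  have hdiff (a S) : ∃ m, r • m = (ζ - differential N ψ ξ) a S := by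
    refine hker _ ?_
    rw [Pi.sub_apply, Pi.sub_apply, map_sub, sub_eq_zero]
    exact (congrFun (congrFun hξζ a) S).symm
  choose ζ' hζ' using hdiff
  have hζ'' : r • (ζ' : Chain p q N) = ζ - differential N ψ ξ := by
    ext a S
    exact hζ' a S
  have hmem : ζ - differential N ψ ξ ∈ piece A p q N (t + 1) (p + t + 1) :=
    Submodule.sub_mem _ hζ (differential_mem ψ hξ)
  refine ⟨ζ', fun a S h => hmem a S fun h0 => h (hr ?_), ?_⟩
  · simp only [smul_zero]
    rw [hζ', h0]
  · have h1 : r • differential N ψ ζ' = r • η := by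
      rw [← map_smul, hζ'', map_sub, ← Module.End.mul_apply, differential_mul_self, hζη]
      simp
    ext a S
    exact hr (congrFun (congrFun h1 a) S)

/-- Depth sensitivity of the strand of inverse polynomials. -/
theorem exact_of_isWeaklyRegular {A : Type*} [CommRing A] {p q : ℕ}
    (ψ : Matrix (Fin p) (Fin q) A) (rs : List A)
    (hrad : ∀ r ∈ rs, r ∈ (Ideal.span (splitScalars ψ)).radical) :
    ∀ (N : Type*) [AddCommGroup N] [Module A N], RingTheory.Sequence.IsWeaklyRegular N rs →
    ∀ t : ℕ, 1 ≤ t → q < p + t + rs.length → ∀ η ∈ piece A p q N t (p + t),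
      differential N ψ η = 0 → η ∈ boundaries N ψ t := by
  induction rs with
  | nil =>
    intro N _ _ _ t _ hq η hη _
    convert Submodule.zero_mem _
    ext a S
    by_contra h
    have h1 := (hη a S h).2
    have h2 := Finset.card_le_univ S
    simp only [Fintype.card_fin, List.length_nil] at h2 hq
    omega
  | cons r rs ih =>
    intro N _ _ hreg t ht hq η hη hc
    rw [RingTheory.Sequence.isWeaklyRegular_cons_iff] at hreg
    obtain ⟨m, hm⟩ := exists_pow_smul_mem ψ (hrad r (by simp))
      (fun Δ ⟨G, hG⟩ => pow_smul_mem_boundaries ψ G hG ht hη hc)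
    have step (θ : Chain p q N) (h : r • θ ∈ boundaries N ψ t) : θ ∈ boundaries N ψ t :=
      mem_boundaries_of_smul_mem ψ hreg.1
        (ih (fun x hx => hrad x (by simp [hx])) _ hreg.2 (t + 1) (by omega)
          (by simp only [List.length_cons] at hq; omega)) h
    induction m with
    | zero => simpa using hm
    | succ m ihm => exact ihm (step _ (by rwa [smul_smul, ← pow_succ']))

/-- The composite of the contractions by all rows of `ψ`. -/
def fullContract (N : Type*) [AddCommGroup N] [Module A N] : Module.End A (Chain p q N) :=
  ((List.finRange p).map (rowContract N ψ)).prod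

lemma rowContract_mul_prod_colWedge {Δ : A} (hG : ψ * G = Δ • (1 : Matrix (Fin p) (Fin p) A))
    (i : Fin p) (L : List (Fin p)) (hi : i ∉ L) :
    rowContract N ψ i * (L.map (colWedge N G)).prod =
      (-1 : ℤ) ^ L.length • ((L.map (colWedge N G)).prod * rowContract N ψ i) := by
  induction L with
  | nil => simp
  | cons l L ih =>
    simp only [List.mem_cons, not_or] at hi
    have h := colWedge_rowContract (N := N) ψ G l i
    rw [hG, Matrix.smul_apply, Matrix.one_apply_ne hi.1, smul_zero, zero_smul] at h
    rw [List.map_cons, List.prod_cons, ← mul_assoc, eq_neg_of_add_eq_zero_right h, end_neg_mul,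
      mul_assoc, ih hi.2, List.length_cons, pow_succ, mul_smul_comm, mul_neg_one, neg_smul,
      mul_assoc]

lemma exists_prod_colWedge_rowContract {Δ : A}
    (hG : ψ * G = Δ • (1 : Matrix (Fin p) (Fin p) A)) (L : List (Fin p)) (hL : L.Nodup) :
    ∃ n : ℕ, (L.map fun i => colWedge N G i * rowContract N ψ i).prod =
      (-1 : ℤ) ^ n • ((L.map (colWedge N G)).prod * (L.map (rowContract N ψ)).prod) := by
  induction L with
  | nil => exact ⟨0, by simp⟩
  | cons i L ih =>
    rw [List.nodup_cons] at hL
    obtain ⟨n, hn⟩ := ih hL.2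
    refine ⟨n + L.length, ?_⟩
    simp only [List.map_cons, List.prod_cons]
    rw [hn, mul_smul_comm, mul_assoc, ← mul_assoc (rowContract N ψ i),
      rowContract_mul_prod_colWedge ψ G hG i L hL.1, smul_mul_assoc, mul_smul_comm, smul_smul,
      pow_add]
    simp only [mul_assoc]

lemma retract_prod_of_mem_piece_zero (hη : η ∈ piece A p q N 0 p) (L : List (Fin p)) :
    (L.map (retract ψ G N)).prod η =
      (L.map fun i => colWedge N G i * rowContract N ψ i).prod η ∧
      (L.map (retract ψ G N)).prod η ∈ piece A p q N 0 p := by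
  induction L with
  | nil => simp [hη]
  | cons i L ih =>
    obtain ⟨s, hs⟩ : ∃ s, p = s + 1 := ⟨p - 1, by have := i.pos; omega⟩
    simp only [List.map_cons, List.prod_cons, Module.End.mul_apply]
    constructor
    · rw [← ih.1, retract]
      simp only [Module.End.mul_apply, proj_of_mem_piece_zero ih.2]
    · have h := ih.2
      generalize (L.map (retract ψ G N)).prod η = θ at h ⊢
      have := retract_mem (s := p - 1) (t := 0) (η := θ) ψ G
        (by rwa [Nat.sub_add_cancel i.pos]) i
      rwa [Nat.sub_add_cancel i.pos] at this

lemma pow_smul_mem_boundaries_zero {Δ : A} (hG : ψ * G = Δ • (1 : Matrix (Fin p) (Fin p) A))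
    (hη : η ∈ piece A p q N 0 p) (hc : fullContract ψ N η = 0) :
    Δ ^ p • η ∈ boundaries N ψ 0 := by
  obtain ⟨-, -, h3⟩ := retract_prod ψ G hG hη
    (differential_apply_eq_zero_of_mem_piece_zero ψ hη) (List.finRange p)
  obtain ⟨n, hn⟩ := exists_prod_colWedge_rowContract (N := N) ψ G hG _ (List.nodup_finRange p)
  have h0 : ((List.finRange p).map (retract ψ G N)).prod η = 0 := by
    rw [(retract_prod_of_mem_piece_zero ψ G hη _).1, hn, LinearMap.smul_apply,
      Module.End.mul_apply]
    rw [fullContract] at hc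
    simp [hc]
  simpa [h0] using h3

/-- Exactness of the Eagon–Northcott complex at its first syzygy module. -/
theorem mem_boundaries_of_fullContract_eq_zero {r : A} {rs : List A}
    (hrad : ∀ x ∈ r :: rs, x ∈ (Ideal.span (splitScalars ψ)).radical)
    (hreg : RingTheory.Sequence.IsWeaklyRegular N (r :: rs)) (hq : q < p + 1 + rs.length)
    (hη : η ∈ piece A p q N 0 p) (hc : fullContract ψ N η = 0) :
    η ∈ boundaries N ψ 0 := by
  rw [RingTheory.Sequence.isWeaklyRegular_cons_iff] at hreg
  obtain ⟨m, hm⟩ := exists_pow_smul_mem ψ (hrad r (by simp))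
    (fun Δ ⟨G, hG⟩ => pow_smul_mem_boundaries_zero ψ G hG hη hc)
  have step (θ : Chain p q N) (h : r • θ ∈ boundaries N ψ 0) : θ ∈ boundaries N ψ 0 :=
    mem_boundaries_of_smul_mem ψ hreg.1
      (exact_of_isWeaklyRegular ψ rs (fun x hx => hrad x (by simp [hx])) _ hreg.2 1 le_rfl hq) h
  induction m with
  | zero => simpa using hm
  | succ m ihm => exact ihm (step _ (by rwa [smul_smul, ← pow_succ']))

lemma det_submatrix_mem_splitScalars (r : Fin p → Fin p) (c : Fin p → Fin q)
    (hr : Function.Injective r) : (ψ.submatrix r c).det ∈ splitScalars ψ := by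
  classical
  set B := ψ.submatrix r c with hB
  let e : Fin p ≃ Fin p := Equiv.ofBijective r hr.bijective_of_finite
  have hψ : ψ.submatrix id c = B.submatrix e.symm id := by
    ext i m
    simp only [hB, submatrix_apply, id]
    rw [show r (e.symm i) = i from e.apply_symm_apply i]
  let E : Matrix (Fin q) (Fin p) A := Matrix.of fun j m => if c m = j then 1 else 0
  have h1 : ψ * E = ψ.submatrix id c := by
    ext i m
    simp [E, mul_apply]
  let F : Matrix (Fin p) (Fin p) A := B.adjugate.submatrix id e.symm
  refine ⟨E * F, ?_⟩
  have h2 : (B.submatrix e.symm id : Matrix (Fin p) (Fin p) A) * F =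
      (B * B.adjugate).submatrix e.symm e.symm :=
    submatrix_mul_equiv B B.adjugate e.symm (Equiv.refl _) e.symm
  rw [← Matrix.mul_assoc, h1, hψ, h2, mul_adjugate]
  ext i m
  simp [one_apply]

lemma minorsIdeal_le_span_splitScalars : minorsIdeal p ψ ≤ Ideal.span (splitScalars ψ) := by
  refine Ideal.span_mono ?_
  rintro _ ⟨r, c, hr, -, rfl⟩
  exact det_submatrix_mem_splitScalars ψ r c hr

section PolynomialRing

variable {k : Type*} [Field k] {d : ℕ}

variable (k) in
lemma isWeaklyRegular_X (d : ℕ) :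
    RingTheory.Sequence.IsWeaklyRegular (MvPolynomial (Fin d) k)
      (List.ofFn (X : Fin d → MvPolynomial (Fin d) k)) := by
  rw [RingTheory.Sequence.isWeaklyRegular_iff]
  intro i hi
  have hi' : i < d := by simpa using hi
  have hI : Ideal.ofList ((List.ofFn (X : Fin d → MvPolynomial (Fin d) k)).take i) =
      Ideal.span (X '' {j : Fin d | (j : ℕ) < i}) := by
    rw [Ideal.ofList]
    congr 1
    ext f
    simp only [Set.mem_ofPred_eq, Set.mem_image, List.mem_take_iff_getElem, List.getElem_ofFn,
      List.length_ofFn]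
    constructor
    · rintro ⟨j, hj, rfl⟩
      exact ⟨⟨j, by omega⟩, by simp; omega, rfl⟩
    · rintro ⟨j, hj, rfl⟩
      exact ⟨j, by simp; omega, rfl⟩
  rw [isSMulRegular_quotient_iff_mem_of_smul_mem, smul_eq_mul, Ideal.mul_top, hI]
  intro f hf
  rw [List.getElem_ofFn, smul_eq_mul, mem_ideal_span_X_image] at hf
  rw [mem_ideal_span_X_image]
  intro m hm
  obtain ⟨j, hj, h⟩ := hf (Finsupp.single ⟨i, hi'⟩ 1 + m) (by
    rw [mem_support_iff, coeff_X_mul]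
    exact mem_support_iff.mp hm)
  refine ⟨j, hj, ?_⟩
  have hne : (⟨i, hi'⟩ : Fin d) ≠ j := by
    rintro rfl
    simp at hj
  simpa [Finsupp.single_apply, hne] using h

lemma isMaximal_idealOfVars : (idealOfVars (Fin d) k).IsMaximal := by
  have : idealOfVars (Fin d) k = RingHom.ker (constantCoeff (R := k) (σ := Fin d)) := by
    ext f
    rw [← pow_one (idealOfVars (Fin d) k), mem_pow_idealOfVars_iff', RingHom.mem_ker]
    simp [constantCoeff_eq, Finsupp.degree_eq_zero_iff]
  rw [this]
  exact RingHom.ker_isMaximal_of_surjective _ fun c => ⟨C c, constantCoeff_C _ c⟩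

variable (k) in
/-- The prime ideal generated by the first `i` variables. -/
def coordPrime (d i : ℕ) : Ideal (MvPolynomial (Fin d) k) :=
  RingHom.ker (aeval fun j : Fin d => if (j : ℕ) < i then 0 else X j :
    MvPolynomial (Fin d) k →ₐ[k] MvPolynomial (Fin d) k)

instance (i : ℕ) : (coordPrime k d i).IsPrime := RingHom.ker_isPrime _

lemma coordPrime_lt_succ {i : ℕ} (hi : i < d) : coordPrime k d i < coordPrime k d (i + 1) := by
  refine SetLike.lt_iff_le_and_exists.mpr ⟨fun f hf => ?_, X ⟨i, hi⟩, ?_, ?_⟩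
  · have h : (aeval fun j : Fin d => if (j : ℕ) < i + 1 then 0 else X j :
        MvPolynomial (Fin d) k →ₐ[k] MvPolynomial (Fin d) k) =
        (aeval fun j : Fin d => if (j : ℕ) < i + 1 then 0 else X j).comp
          (aeval fun j : Fin d => if (j : ℕ) < i then 0 else X j) := by
      ext1 j
      by_cases hj : (j : ℕ) < i
      · simp [hj, hj.le]
      · simp [hj]
    rw [coordPrime, RingHom.mem_ker] at hf ⊢
    erw [h, AlgHom.comp_apply, hf, map_zero]
  · simp [coordPrime, RingHom.mem_ker]
  · simp [coordPrime, RingHom.mem_ker]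

lemma le_height_coordPrime {i : ℕ} (hi : i ≤ d) : (i : ℕ∞) ≤ (coordPrime k d i).height := by
  induction i with
  | zero => simp
  | succ i ih =>
    have := Ideal.height_add_one_le_of_lt_of_isPrime (coordPrime_lt_succ (k := k) hi)
    push_cast
    exact (add_le_add_left (ih (by omega)) 1).trans this

lemma coordPrime_le_idealOfVars : coordPrime k d d ≤ idealOfVars (Fin d) k := by
  intro f hf
  rw [← pow_one (idealOfVars (Fin d) k), mem_pow_idealOfVars_iff']
  intro x hx
  have hx : x = 0 := by simpa [Finsupp.degree_eq_zero_iff] using hx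
  rw [coordPrime, RingHom.mem_ker] at hf
  have h : (aeval fun j : Fin d => if (j : ℕ) < d then 0 else X j :
        MvPolynomial (Fin d) k →ₐ[k] MvPolynomial (Fin d) k) = aeval fun _ => 0 := by
    congr 1
    ext1 j
    simp
  rw [hx]
  have hf' : (aeval (fun _ => 0) : MvPolynomial (Fin d) k →ₐ[k] MvPolynomial (Fin d) k) f = 0 := by
    rw [← h]; exact hf
  rw [aeval_zero'] at hf'
  simpa [constantCoeff_eq] using hf'

lemma height_idealOfVars : (idealOfVars (Fin d) k).height = d := by
  have := isMaximal_idealOfVars (k := k) (d := d)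
  refine le_antisymm ?_
    ((le_height_coordPrime le_rfl).trans (Ideal.height_mono coordPrime_le_idealOfVars))
  have h := Ideal.height_le_ringKrullDim_of_ne_top this.ne_top
  rw [MvPolynomial.ringKrullDim_of_isNoetherianRing] at h
  simp at h
  exact_mod_cast h

end PolynomialRing

section Height

attribute [local instance] MvPolynomial.gradedAlgebra

variable {k : Type*} [Field k] {d : ℕ}

lemma le_idealHeight_iff {I : Ideal A} {c : ℕ∞} :
    c ≤ idealHeight I ↔ ∀ P : Ideal A, P.IsPrime → I ≤ P → c ≤ P.height := by
  simp only [idealHeight, le_iInf_iff]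
  refine ⟨fun h P hP hI => ?_, fun h P hI => ?_⟩
  · exact (h ⟨P, hP⟩ hI).trans_eq (PrimeSpectrum.height_eq_orderHeight ⟨P, hP⟩).symm
  · exact (h _ P.isPrime hI).trans_eq P.height_eq_orderHeight

lemma idealHeight_le {I P : Ideal A} (hP : P.IsPrime) (hI : I ≤ P) : idealHeight I ≤ P.height :=
  le_idealHeight_iff.mp le_rfl P hP hI

lemma isHomogeneous_det {m : ℕ} (M : Matrix (Fin m) (Fin m) (MvPolynomial (Fin d) k))
    (hM : ∀ i j, (M i j).IsHomogeneous 1) : M.det.IsHomogeneous m := by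
  rw [det_apply]
  refine IsHomogeneous.sum _ _ _ fun σ _ => ?_
  have h : (∏ i, M (σ i) i).IsHomogeneous m := by
    simpa using IsHomogeneous.prod Finset.univ _ (fun _ => 1) fun i _ => hM (σ i) i
  rw [Units.smul_def, zsmul_eq_mul]
  simpa using (isHomogeneous_C (Fin d) (((Equiv.Perm.sign σ : ℤ)) : k)).mul h

variable {ψ : Matrix (Fin p) (Fin q) (MvPolynomial (Fin d) k)}

lemma minorsIdeal_le_pow (hψ : ∀ i j, (ψ i j).IsHomogeneous 1) (m : ℕ) :
    minorsIdeal m ψ ≤ idealOfVars (Fin d) k ^ m := by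
  refine Ideal.span_le.mpr ?_
  rintro _ ⟨r, c, -, -, rfl⟩
  rw [SetLike.mem_coe, mem_pow_idealOfVars_iff]
  intro x hx
  have := isHomogeneous_det (ψ.submatrix r c) (fun i j => hψ _ _) (mem_support_iff.mp hx)
  exact (this.symm.trans (congrArg (· x) Finsupp.degree_eq_weight_one.symm)).le

lemma minorsIdeal_isHomogeneous (hψ : ∀ i j, (ψ i j).IsHomogeneous 1) (m : ℕ) :
    (minorsIdeal m ψ).IsHomogeneous (homogeneousSubmodule (Fin d) k) := by
  refine Ideal.homogeneous_span _ _ ?_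
  rintro _ ⟨r, c, -, -, rfl⟩
  exact ⟨m, isHomogeneous_det (ψ.submatrix r c) (fun i j => hψ _ _)⟩

lemma le_idealOfVars_of_isHomogeneous {Q : Ideal (MvPolynomial (Fin d) k)}
    (hQ : Q.IsHomogeneous (homogeneousSubmodule (Fin d) k)) (htop : Q ≠ ⊤) :
    Q ≤ idealOfVars (Fin d) k := by
  intro f hf
  rw [← pow_one (idealOfVars (Fin d) k), mem_pow_idealOfVars_iff']
  intro x hx
  have hx : x = 0 := by simpa [Finsupp.degree_eq_zero_iff] using hx
  rw [hx]
  by_contra h0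
  have h1 := (mem_iff_homogeneousComponent_mem hQ f).mp hf 0
  rw [homogeneousComponent_zero] at h1
  exact htop (Ideal.eq_top_of_isUnit_mem _ h1 ((isUnit_iff_ne_zero.mpr h0).map C))

lemma idealOfVars_le_radical {I : Ideal (MvPolynomial (Fin d) k)}
    (hI : I.IsHomogeneous (homogeneousSubmodule (Fin d) k)) (hh : (d : ℕ∞) ≤ idealHeight I) :
    idealOfVars (Fin d) k ≤ I.radical := by
  rw [Ideal.radical_eq_sInf]
  refine le_sInf ?_
  rintro P ⟨hIP, hP⟩
  have hm := isMaximal_idealOfVars (k := k) (d := d)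
  set Q := (P.homogeneousCore (homogeneousSubmodule (Fin d) k)).toIdeal with hQdef
  have hQ : Q.IsPrime := hP.homogeneousCore
  have hIQ : I ≤ Q := by
    rw [← hI.toIdeal_homogeneousCore_eq_self]
    exact Ideal.homogeneousCore_mono _ hIP
  have hle : Q ≤ idealOfVars (Fin d) k :=
    le_idealOfVars_of_isHomogeneous (P.homogeneousCore _).isHomogeneous hQ.ne_top
  have hQP : Q ≤ P := Ideal.toIdeal_homogeneousCore_le _ _
  rcases hle.lt_or_eq with hlt | heq
  · have h1 := Ideal.height_add_one_le_of_lt_of_isPrime hlt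
    rw [height_idealOfVars] at h1
    have h2 := (add_le_add_left (hh.trans (idealHeight_le hQ hIQ)) 1).trans h1
    exact absurd h2 (by exact_mod_cast (Nat.lt_succ_self d).not_ge)
  · rwa [← heq]

lemma idealHeight_pow_idealOfVars {m : ℕ} (hm : m ≠ 0) :
    idealHeight (idealOfVars (Fin d) k ^ m) = d := by
  have hmax := isMaximal_idealOfVars (k := k) (d := d)
  refine le_antisymm ?_ (le_idealHeight_iff.mpr fun P hP hI => ?_)
  · rw [← height_idealOfVars (k := k)]
    exact idealHeight_le hmax.isPrime (Ideal.pow_le_self hm)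
  · rw [← height_idealOfVars (k := k)]
    exact Ideal.height_mono (hP.le_of_pow_le hI)

end Height

lemma fullContract_eq_lift : fullContract ψ N =
    ExteriorAlgebra.lift A ⟨contraction N, contraction_mul_self⟩
      (ExteriorAlgebra.ιMulti A p fun i => ψ i) := by
  rw [ExteriorAlgebra.ιMulti_apply, map_list_prod, List.map_ofFn, fullContract, List.ofFn_eq_map]
  congr 1
  refine List.map_congr_left fun i _ => ?_
  rw [Function.comp_apply, ExteriorAlgebra.lift_ι_apply, rowContract_eq_contraction]

lemma fullContract_apply_mem (η : Chain p q A) (a S) :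
    fullContract ψ A η a S ∈ minorsIdeal p ψ := by
  classical
  let b := (Pi.basisFun A (Fin q)).exteriorPower p
  let ev : ⋀[A]^p (Fin q → A) →ₗ[A] A :=
    LinearMap.proj S ∘ₗ LinearMap.proj a ∘ₗ LinearMap.applyₗ η ∘ₗ
      (ExteriorAlgebra.lift A ⟨contraction A, contraction_mul_self⟩).toLinearMap ∘ₗ
        (⋀[A]^p (Fin q → A)).subtype
  have h : fullContract ψ A η a S = ev (exteriorPower.ιMulti A p fun i => ψ i) := by
    rw [fullContract_eq_lift]
    rfl
  rw [h, ← b.sum_repr (exteriorPower.ιMulti A p fun i => ψ i), map_sum]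
  refine Ideal.sum_mem _ fun s _ => ?_
  rw [map_smul, smul_eq_mul]
  refine Ideal.mul_mem_right _ _ (Ideal.subset_span ?_)
  refine ⟨id, Set.powersetCard.ofFinEmbEquiv.symm s, Function.injective_id,
    (Set.powersetCard.ofFinEmbEquiv.symm s).injective, ?_⟩
  rw [exteriorPower.basis_repr_apply, exteriorPower.ιMultiDual_apply_ιMulti]
  congr 1

section Linear

variable {k : Type*} [Field k] {d : ℕ} {ψ : Matrix (Fin p) (Fin q) (MvPolynomial (Fin d) k)}

lemma isHomogeneous_rowContract (hψ : ∀ i j, (ψ i j).IsHomogeneous 1) {e : ℕ}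
    {η : Chain p q (MvPolynomial (Fin d) k)} (hη : ∀ a S, (η a S).IsHomogeneous e) (i : Fin p)
    (a S) : (rowContract _ ψ i η a S).IsHomogeneous (e + 1) := by
  simp only [rowContract, LinearMap.sum_apply, Finset.sum_apply, LinearMap.smul_apply,
    Pi.smul_apply, remove_apply, smul_eq_mul, zsmul_eq_mul]
  refine IsHomogeneous.sum _ _ _ fun j _ => ?_
  rw [add_comm e]
  refine (hψ i j).mul ?_
  split_ifs
  · exact isHomogeneous_zero _ _ _
  · simpa using (isHomogeneous_C (Fin d) ((colSign j S : ℤ) : k)).mul (hη a (insert j S))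

lemma isHomogeneous_prod_rowContract (hψ : ∀ i j, (ψ i j).IsHomogeneous 1) {e : ℕ}
    {η : Chain p q (MvPolynomial (Fin d) k)} (hη : ∀ a S, (η a S).IsHomogeneous e)
    (L : List (Fin p)) (a S) :
    ((L.map (rowContract _ ψ)).prod η a S).IsHomogeneous (e + L.length) := by
  induction L generalizing a S with
  | nil => simpa using hη a S
  | cons i L ih =>
    rw [List.map_cons, List.prod_cons, Module.End.mul_apply, List.length_cons, ← add_assoc]
    exact isHomogeneous_rowContract hψ ih i a S

lemma boundaries_apply_mem (hψ : ∀ i j, (ψ i j).IsHomogeneous 1) {t : ℕ}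
    {η : Chain p q (MvPolynomial (Fin d) k)} (hη : η ∈ boundaries _ ψ t) (a S) :
    η a S ∈ idealOfVars (Fin d) k := by
  obtain ⟨ζ, -, rfl⟩ := hη
  simp only [differential, rowContract, LinearMap.sum_apply, Finset.sum_apply, LinearMap.smul_apply,
    Pi.smul_apply, Module.End.mul_apply]
  refine Ideal.sum_mem _ fun i _ => Ideal.sum_mem _ fun j _ => Ideal.mul_mem_right _ _ ?_
  rw [← pow_one (idealOfVars (Fin d) k), mem_pow_idealOfVars_iff]
  intro x hx
  have := hψ i j (mem_support_iff.mp hx)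
  exact (this.symm.trans (congrArg (· x) Finsupp.degree_eq_weight_one.symm)).le

variable (p q d k) in
/-- Exterior forms with constant coefficients, as chains. -/
def constChain : ({S : Finset (Fin q) // S.card = p} → k) →ₗ[k]
    Chain p q (MvPolynomial (Fin d) k) where
  toFun ω a S := if h : a = 0 ∧ S.card = p then C (ω ⟨S, h.2⟩) else 0
  map_add' ω ω' := by
    ext1 a; ext1 S
    simp only [Pi.add_apply]
    split_ifs <;> simp
  map_smul' c ω := by
    ext1 a; ext1 S
    simp only [Pi.smul_apply, RingHom.id_apply]
    split_ifs <;> simp [smul_eq_C_mul]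

lemma constChain_apply (ω : {S : Finset (Fin q) // S.card = p} → k) (a S) :
    constChain p q k d ω a S = if h : a = 0 ∧ S.card = p then C (ω ⟨S, h.2⟩) else 0 := rfl

lemma constChain_mem (ω : {S : Finset (Fin q) // S.card = p} → k) :
    constChain p q k d ω ∈ piece (MvPolynomial (Fin d) k) p q (MvPolynomial (Fin d) k) 0 p := by
  intro a S h
  rw [constChain_apply] at h
  split_ifs at h with h'
  · simp [h'.1, h'.2]
  · exact absurd rfl h

lemma isHomogeneous_constChain (ω : {S : Finset (Fin q) // S.card = p} → k) (a S) :
    (constChain p q k d ω a S).IsHomogeneous 0 := by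
  rw [constChain_apply]
  split_ifs
  · exact isHomogeneous_C _ _
  · exact isHomogeneous_zero _ _ _

/-- The linear map sending a constant exterior form of degree `p` to its contraction by all
rows of `ψ`. -/
def contractConst (hψ : ∀ i j, (ψ i j).IsHomogeneous 1) :
    ({S : Finset (Fin q) // S.card = p} → k) →ₗ[k] homogeneousSubmodule (Fin d) k p :=
  LinearMap.codRestrict _
    (LinearMap.proj ∅ ∘ₗ LinearMap.proj 0 ∘ₗ (fullContract ψ _).restrictScalars k ∘ₗ
      constChain p q k d)
    fun ω => by
      simpa [fullContract] using isHomogeneous_prod_rowContract hψ (isHomogeneous_constChain ω)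
        (List.finRange p) 0 ∅

lemma coe_contractConst (hψ : ∀ i j, (ψ i j).IsHomogeneous 1)
    (ω : {S : Finset (Fin q) // S.card = p} → k) :
    (contractConst hψ ω : MvPolynomial (Fin d) k) =
      fullContract ψ _ (constChain p q k d ω) 0 ∅ := rfl

lemma prod_rowContract_mem {s : ℕ} {η : Chain p q N} (ψ : Matrix (Fin p) (Fin q) A)
    (L : List (Fin p)) (hη : η ∈ piece A p q N 0 (s + L.length)) :
    (L.map (rowContract N ψ)).prod η ∈ piece A p q N 0 s := by
  induction L generalizing s with
  | nil => simpa using hη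
  | cons i L ih =>
    rw [List.map_cons, List.prod_cons, Module.End.mul_apply]
    exact rowContract_mem ψ (ih (by simpa [add_assoc, add_comm 1] using hη)) i

lemma contractConst_injective (hψ : ∀ i j, (ψ i j).IsHomogeneous 1) (hq : q < p + d)
    (hd : 1 ≤ d) (hI : (d : ℕ∞) ≤ idealHeight (minorsIdeal p ψ)) :
    Function.Injective (contractConst hψ) := by
  rw [injective_iff_map_eq_zero]
  intro ω hω
  have h0 : fullContract ψ _ (constChain p q k d ω) = 0 := by
    have hmem := prod_rowContract_mem (s := 0) ψ (List.finRange p)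
      (by simpa using constChain_mem (d := d) ω)
    ext1 a; ext1 S
    by_contra hne
    obtain ⟨ha, hS⟩ := hmem a S hne
    have ha : a = 0 := by ext i; simpa using Finset.sum_eq_zero_iff.mp ha i (Finset.mem_univ i)
    obtain rfl := Finset.card_eq_zero.mp hS
    rw [ha, ← coe_contractConst hψ, hω] at hne
    exact hne rfl
  obtain ⟨e, rfl⟩ := Nat.exists_eq_add_of_le' hd
  have hreg := isWeaklyRegular_X k (e + 1)
  rw [List.ofFn_succ] at hreg
  have hb := mem_boundaries_of_fullContract_eq_zero ψ (fun x hx => ?_) hreg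
    (by simp; omega) (constChain_mem ω) h0
  · ext S
    have h1 := boundaries_apply_mem hψ hb 0 S.1
    rw [constChain_apply, dif_pos ⟨rfl, S.2⟩, ← pow_one (idealOfVars _ k),
      C_mem_pow_idealOfVars_iff] at h1
    simpa using h1
  · have hx : x ∈ Set.range (X : Fin (e + 1) → MvPolynomial (Fin (e + 1)) k) := by
      rw [← List.ofFn_succ (f := (X : Fin (e + 1) → MvPolynomial (Fin (e + 1)) k))] at hx
      exact List.mem_ofFn.mp hx
    exact Ideal.radical_mono (minorsIdeal_le_span_splitScalars ψ)
      (idealOfVars_le_radical (minorsIdeal_isHomogeneous hψ p) hI (Ideal.subset_span hx))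

lemma homogeneousSubmodule_eq_restrictSupport (d m : ℕ) :
    homogeneousSubmodule (Fin d) k m =
      restrictSupport k (Finset.finsuppAntidiag (Finset.univ : Finset (Fin d)) m : Set _) := by
  rw [homogeneousSubmodule_eq_finsupp_supported, restrictSupport]
  congr 1
  ext x
  simp [Finsupp.degree_eq_sum]

variable (k) in
lemma finrank_homogeneousSubmodule (d m : ℕ) :
    Module.finrank k (homogeneousSubmodule (Fin d) k m) = (d + m - 1).choose m := by
  rw [homogeneousSubmodule_eq_restrictSupport]
  refine (Module.finrank_eq_nat_card_basis (basisRestrictSupport k _)).trans ?_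
  rw [Nat.card_coe_set_eq, Set.ncard_coe_finset, Finset.card_finsuppAntidiag_nat_eq_choose,
    Finset.card_univ, Fintype.card_fin]

variable (k) in
lemma finite_homogeneousSubmodule (d m : ℕ) :
    Module.Finite k (homogeneousSubmodule (Fin d) k m) := by
  rw [homogeneousSubmodule_eq_restrictSupport]
  exact Module.Finite.of_basis (basisRestrictSupport k _)

lemma contractConst_surjective (hψ : ∀ i j, (ψ i j).IsHomogeneous 1) (hq : q + 1 = p + d)
    (hd : 1 ≤ d) (hI : (d : ℕ∞) ≤ idealHeight (minorsIdeal p ψ)) :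
    Function.Surjective (contractConst hψ) := by
  have : Module.Finite k (homogeneousSubmodule (Fin d) k p) := finite_homogeneousSubmodule k d p
  refine (LinearMap.injective_iff_surjective_of_finrank_eq_finrank ?_).mp
    (contractConst_injective hψ (by omega) hd hI)
  rw [finrank_homogeneousSubmodule, Module.finrank_fintype_fun_eq_card, Fintype.card_finset_len,
    Fintype.card_fin]
  congr 1
  omega

lemma pow_le_minorsIdeal (hψ : ∀ i j, (ψ i j).IsHomogeneous 1) (hq : q + 1 = p + d)
    (hd : 1 ≤ d) (hI : (d : ℕ∞) ≤ idealHeight (minorsIdeal p ψ)) :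
    idealOfVars (Fin d) k ^ p ≤ minorsIdeal p ψ := by
  rw [pow_idealOfVars_eq_span, Ideal.span_le]
  rintro _ ⟨x, hx, rfl⟩
  obtain ⟨ω, hω⟩ := contractConst_surjective hψ hq hd hI
    ⟨monomial x 1, isHomogeneous_monomial 1 hx⟩
  have h := congrArg Subtype.val hω
  rw [coe_contractConst] at h
  change monomial x (1 : k) ∈ minorsIdeal p ψ
  rw [show monomial x (1 : k) = _ from h.symm]
  exact fullContract_apply_mem ψ _ _ _

end Linear

end InverseKoszul

end

/-- Let `ψ : R(−1)^{n−1} → R^{n−d}` be given by an `(n−d)×(n−1)` matrix of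
linear forms over `R = k[x_1,…,x_d]`.  Then `I_{n−d}(ψ) = (x_1,…,x_d)^{n−d}` if and only if
`ht I_{n−d}(ψ) = d`. -/
theorem statement7 {k : Type*} [Field k] {d n : ℕ} (hd : 1 ≤ d) (hdn : d + 1 ≤ n)
    (ψ : Matrix (Fin (n - d)) (Fin (n - 1)) (MvPolynomial (Fin d) k))
    (hdeg : ∀ i j, (ψ i j).IsHomogeneous 1) :
    minorsIdeal (n - d) ψ =
        (Ideal.span (Set.range (MvPolynomial.X : Fin d → MvPolynomial (Fin d) k))) ^ (n - d) ↔
      idealHeight (minorsIdeal (n - d) ψ) = (d : ℕ∞) := by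
  obtain ⟨e, rfl⟩ := Nat.exists_eq_add_of_le hdn
  have hne : d + 1 + e - d ≠ 0 := by omega
  refine ⟨fun h => ?_, fun h => ?_⟩
  · rw [h]
    exact InverseKoszul.idealHeight_pow_idealOfVars hne
  · exact le_antisymm (InverseKoszul.minorsIdeal_le_pow hdeg _)
      (InverseKoszul.pow_le_minorsIdeal hdeg (by omega) hd h.ge)
end
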